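/- arXiv:2307.07833 — 6 statements merged into one kernel-verified Lean document; each statement's English description precedes it below -/
import Mathlib

section
/- Let 0 ≤ i ≤ N and let y ∈ X be a vertex of dimension i. Then the number of vertices z ∈ X that cover y (i.e., y ⊆ z with dim z = dim y + 1) equals q^M [N−i]_q = q^M (q^{N−i} − 1)/(q − 1). -/
open Module Matrix Finset

noncomputable section

open scoped Classical

variable {F H : Type} [Field F] [Fintype F] [AddCommGroup H] [Module F H]
  [FiniteDimensional F H]

/-- The vertex set of the Attenuated Space poset `A_q(N,M)`:
the subspaces of `H` that intersect `h` trivially. -/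
def AttX (h : Submodule F H) := {y : Submodule F H // y ⊓ h = ⊥}

instance (h : Submodule F H) : Fintype (AttX h) := by
  have : Finite H := Module.finite_of_finite F
  have : Finite (Submodule F H) :=
    Finite.of_injective (fun y : Submodule F H => (y : Set H)) SetLike.coe_injective
  have : Finite (AttX h) := Subtype.finite
  exact Fintype.ofFinite _

/-- The dimension of a vertex. -/
def vdim (h : Submodule F H) (y : AttX h) : ℕ := finrank F (y.1 : Submodule F H)

/-- `AttCovers h y z` means that `z` covers `y`: `y ⊆ z` and `dim z = dim y + 1`. -/
def AttCovers (h : Submodule F H) (y z : AttX h) : Prop :=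
  y.1 ≤ z.1 ∧ vdim h z = vdim h y + 1

theorem sup_span_singleton_inf_eq_bot {K V : Type*} [Field K] [AddCommGroup V] [Module K V]
    {y h : Submodule K V} (hyh : y ⊓ h = ⊥) {v : V} (hv : v ∉ y ⊔ h) :
    (y ⊔ Submodule.span K {v}) ⊓ h = ⊥ := by
  rw [Submodule.eq_bot_iff]
  rintro x ⟨hx, hxh⟩
  obtain ⟨a, ha, w, hw, rfl⟩ := Submodule.mem_sup.1 hx
  obtain ⟨c, rfl⟩ := Submodule.mem_span_singleton.1 hw
  by_cases hc : c = 0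
  · subst hc
    rw [zero_smul, add_zero] at hxh ⊢
    exact (Submodule.eq_bot_iff _).1 hyh a ⟨ha, hxh⟩
  · refine absurd ?_ hv
    rw [← Submodule.smul_mem_iff _ hc, ← add_sub_cancel_left a (c • v)]
    exact sub_mem (Submodule.mem_sup_right hxh) (Submodule.mem_sup_left ha)

theorem finrank_sup_span_singleton_of_notMem {K V : Type*} [Field K] [AddCommGroup V]
    [Module K V] [FiniteDimensional K V] {y : Submodule K V} {v : V} (hv : v ∉ y) :
    finrank K ↥(y ⊔ Submodule.span K {v}) = finrank K y + 1 := by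
  have hv0 : v ≠ 0 := fun h0 => hv (h0 ▸ y.zero_mem)
  have hdisj : y ⊓ Submodule.span K {v} = ⊥ :=
    ((Submodule.disjoint_span_singleton' hv0).2 hv).eq_bot
  have := Submodule.finrank_sup_add_finrank_inf_eq y (Submodule.span K {v})
  rwa [hdisj, finrank_bot, finrank_span_singleton hv0, add_zero] at this

/-- For a cover `z` of `y`, the vectors outside `y ⊔ h` that together with `y` span `z` are
those of `z` outside `y`. -/
theorem notMem_sup_and_sup_span_singleton_eq_iff {K V : Type*} [Field K] [AddCommGroup V]
    [Module K V] [FiniteDimensional K V] {y z h : Submodule K V} (hzh : z ⊓ h = ⊥) (hyz : y ≤ z)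
    (hdim : finrank K z = finrank K y + 1) (v : V) :
    (v ∉ y ⊔ h ∧ y ⊔ Submodule.span K {v} = z) ↔ v ∈ z ∧ v ∉ y := by
  constructor
  · rintro ⟨hv, rfl⟩
    exact ⟨Submodule.mem_sup_right (Submodule.mem_span_singleton_self v),
      fun hy => hv (Submodule.mem_sup_left hy)⟩
  · rintro ⟨hvz, hvy⟩
    refine ⟨fun hv => hvy ?_, Submodule.eq_of_le_of_finrank_eq ?_ ?_⟩
    · obtain ⟨a, ha, b, hb, rfl⟩ := Submodule.mem_sup.1 hv
      have hb0 : b = 0 := (Submodule.eq_bot_iff _).1 hzh b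
        ⟨(Submodule.add_mem_iff_right z (hyz ha)).1 hvz, hb⟩
      rwa [hb0, add_zero]
    · exact sup_le hyz ((Submodule.span_singleton_le_iff_mem v z).2 hvz)
    · rw [finrank_sup_span_singleton_of_notMem hvy, hdim]

theorem card_filter_mem_and_notMem {K V : Type*} [Field K] [Fintype K] [AddCommGroup V]
    [Module K V] [Fintype V] {y z : Submodule K V} (hyz : y ≤ z) :
    (univ.filter fun v : V => v ∈ z ∧ v ∉ y).card
      = Fintype.card K ^ finrank K z - Fintype.card K ^ finrank K y := by
  have hcard (w : Submodule K V) :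
      (univ.filter fun v : V => v ∈ w).card = Fintype.card K ^ finrank K w := by
    rw [← Module.card_eq_pow_finrank (K := K) (V := w), Fintype.card_subtype]
  rw [filter_and_not, card_sdiff_of_subset (monotone_filter_right _ fun _ _ hv => hyz hv),
    hcard, hcard]

theorem card_covers_mul (h : Submodule F H) (y : AttX h) :
    (univ.filter fun z : AttX h => AttCovers h y z).card *
        (Fintype.card F ^ (vdim h y + 1) - Fintype.card F ^ vdim h y)
      = Fintype.card F ^ finrank F H - Fintype.card F ^ (vdim h y + finrank F h) := by
  have : Finite H := Module.finite_of_finite F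
  have := Fintype.ofFinite H
  have hsup : finrank F ↥(y.1 ⊔ h) = vdim h y + finrank F h := by
    have := Submodule.finrank_sup_add_finrank_inf_eq y.1 h
    rwa [y.2, finrank_bot, add_zero] at this
  have htotal := card_filter_mem_and_notMem (le_top : y.1 ⊔ h ≤ ⊤)
  simp only [Submodule.mem_top, true_and, finrank_top, hsup] at htotal
  let T := (univ.filter fun z : AttX h => AttCovers h y z).map
    ⟨fun z => z.1, fun _ _ => Subtype.ext⟩
  have hmaps : ∀ v ∈ univ.filter fun v : H => v ∉ y.1 ⊔ h, y.1 ⊔ Submodule.span F {v} ∈ T := by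
    intro v hv
    have hv := (mem_filter.1 hv).2
    refine mem_map.2 ⟨⟨_, sup_span_singleton_inf_eq_bot y.2 hv⟩,
      mem_filter.2 ⟨mem_univ _, le_sup_left, ?_⟩, rfl⟩
    exact finrank_sup_span_singleton_of_notMem fun hy => hv (Submodule.mem_sup_left hy)
  rw [← htotal, card_eq_sum_card_fiberwise hmaps, sum_map, ← smul_eq_mul, ← sum_const]
  refine sum_congr rfl fun z hz => ?_
  obtain ⟨hyz, hdim⟩ := (mem_filter.1 hz).2
  have hfiber := card_filter_mem_and_notMem hyz
  rw [← filter_congr fun v _ =>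
    notMem_sup_and_sup_span_singleton_eq_iff z.2 hyz hdim v] at hfiber
  rw [filter_filter, ← hdim]
  exact hfiber.symm

/-- a vertex `y` of dimension `i` is covered by exactly
`q^M [N-i]_q = q^M (q^(N-i) - 1)/(q - 1)` vertices. -/
theorem stmt1 (q N M : ℕ) (hq : Fintype.card F = q) (hN : 0 < N) (hM : 0 < M)
    (h : Submodule F H) (hH : finrank F H = N + M) (hh : finrank F h = M)
    (i : ℕ) (hi : i ≤ N) (y : AttX h) (hy : vdim h y = i) :
    (Finset.univ.filter fun z : AttX h => AttCovers h y z).card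
      = q ^ M * ((q ^ (N - i) - 1) / (q - 1)) := by
  subst hq hh hy
  have hq : 1 < Fintype.card F := Fintype.one_lt_card
  obtain ⟨k, rfl⟩ := Nat.exists_eq_add_of_le hi
  rw [Nat.add_sub_cancel_left]
  refine Nat.eq_of_mul_eq_mul_right
    (Nat.sub_pos_of_lt (Nat.pow_lt_pow_right hq (Nat.lt_succ_self (vdim h y)))) ?_
  rw [card_covers_mul, hH]
  obtain ⟨s, hs⟩ := Nat.sub_one_dvd_pow_sub_one (Fintype.card F) k
  rw [hs, Nat.mul_div_cancel_left _ (Nat.sub_pos_of_lt hq)]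
  calc Fintype.card F ^ (vdim h y + k + finrank F h) - Fintype.card F ^ (vdim h y + finrank F h)
      = Fintype.card F ^ vdim h y * Fintype.card F ^ finrank F h * (Fintype.card F ^ k - 1) := by
        rw [Nat.mul_sub, mul_one]
        ring_nf
    _ = Fintype.card F ^ finrank F h * s *
          (Fintype.card F ^ vdim h y * (Fintype.card F - 1)) := by
        rw [hs]
        ring
    _ = _ := by rw [Nat.mul_sub, mul_one, ← pow_succ]
end
end

section
/- For 0 ≤ i ≤ N, the number of vertices y ∈ X with dim y = i equals q^{Mi} · binom(N,i)_q, where binom(N,i)_q is the Gaussian binomial coefficient. -/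
open Module Matrix Finset

noncomputable section

open scoped Classical

variable {F H : Type} [Field F] [Fintype F] [AddCommGroup H] [Module F H]
  [FiniteDimensional F H]

/-- The `q`-integer `[n]_q = (q^n - 1)/(q - 1)`. -/
def qInt (q n : ℕ) : ℕ := (q ^ n - 1) / (q - 1)

/-- The `q`-factorial `[n]_q!`. -/
def qFact (q : ℕ) : ℕ → ℕ
  | 0 => 1
  | n + 1 => qInt q (n + 1) * qFact q n

/-- The Gaussian binomial coefficient `binom(n,i)_q`. -/
def qBinom (q n i : ℕ) : ℕ := qFact q n / (qFact q i * qFact q (n - i))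

theorem qInt_mul_sub_one {q : ℕ} (n : ℕ) : qInt q n * (q - 1) = q ^ n - 1 :=
  Nat.div_mul_cancel (by simpa using Nat.sub_dvd_pow_sub_pow q 1 n)

theorem qInt_succ {q : ℕ} (hq : 1 < q) (n : ℕ) : qInt q (n + 1) = q * qInt q n + 1 := by
  have hpos : 0 < q - 1 := by omega
  apply Nat.eq_of_mul_eq_mul_right hpos
  rw [add_mul, mul_assoc, qInt_mul_sub_one, qInt_mul_sub_one, pow_succ']
  have h1 : 1 ≤ q ^ n := Nat.one_le_pow _ _ (by omega)
  zify [h1, hq.le, show 1 ≤ q * q ^ n from Nat.mul_pos (by omega) h1]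
  ring

theorem qInt_pos {q : ℕ} (hq : 1 < q) (n : ℕ) : 0 < qInt q (n + 1) := by
  rw [qInt_succ hq]
  omega

theorem qFact_pos {q : ℕ} (hq : 1 < q) (n : ℕ) : 0 < qFact q n := by
  induction n with
  | zero => exact one_pos
  | succ n ih => exact Nat.mul_pos (qInt_pos hq n) ih

theorem coprime_qFact {q : ℕ} (hq : 1 < q) (n : ℕ) : Nat.Coprime (qFact q n) q := by
  induction n with
  | zero => exact Nat.coprime_one_left q
  | succ n ih =>
    refine Nat.Coprime.mul_left ?_ ih
    rw [qInt_succ hq]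
    simp

theorem prod_qInt_mul_qFact (q : ℕ) {n i : ℕ} (hi : i ≤ n) :
    (∏ j ∈ range i, qInt q (n - j)) * qFact q (n - i) = qFact q n := by
  induction i with
  | zero => simp
  | succ i ih =>
    rw [prod_range_succ, mul_assoc, ← ih (by omega)]
    congr 1
    obtain ⟨m, hm⟩ : ∃ m, n - i = m + 1 := ⟨n - i - 1, by omega⟩
    rw [show n - (i + 1) = m by omega, hm, qFact]

theorem pow_sub_pow_eq_mul_qInt (q : ℕ) {n j : ℕ} (hj : j ≤ n) :
    q ^ n - q ^ j = q ^ j * (q - 1) * qInt q (n - j) := by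
  rw [mul_assoc, mul_comm (q - 1), qInt_mul_sub_one, Nat.mul_sub, mul_one, ← pow_add,
    Nat.add_sub_cancel' hj]

theorem prod_pow_sub_pow_mul_qFact (q : ℕ) {n i : ℕ} (hi : i ≤ n) :
    (∏ j : Fin i, (q ^ n - q ^ (j : ℕ))) * qFact q (n - i) =
      (∏ j ∈ range i, q ^ j * (q - 1)) * qFact q n := by
  rw [Fin.prod_univ_eq_prod_range (fun j => q ^ n - q ^ j), ← prod_qInt_mul_qFact q hi,
    ← mul_assoc, ← prod_mul_distrib]
  congr 1
  exact prod_congr rfl fun j hj => pow_sub_pow_eq_mul_qInt q (by grind)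

/-- Tuples in `H` that are independent modulo `h`, as tuples in `H ⧸ h` with a choice of lifts. -/
def linearIndependentMkQEquiv (h : Submodule F H) (i : ℕ) :
    {s : Fin i → H // LinearIndependent F (h.mkQ ∘ s)} ≃
      {t : Fin i → H ⧸ h // LinearIndependent F t} × (Fin i → h) where
  toFun s := (⟨h.mkQ ∘ s.1, s.2⟩, fun j => ⟨s.1 j - (h.mkQ (s.1 j)).out, by
    rw [← Submodule.Quotient.mk_eq_zero h]
    simp⟩)
  invFun p := ⟨fun j => (p.1.1 j).out + p.2 j, by
    convert p.1.2 using 1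
    ext j
    simp⟩
  left_inv s := by
    ext j
    simp
  right_inv p := by
    have key (j : Fin i) : h.mkQ ((p.1.1 j).out + p.2 j) = p.1.1 j := by simp
    ext j
    · exact key j
    · simp only [key]
      simp

theorem card_linearIndependent_mkQ (h : Submodule F H) {i : ℕ} (hi : i ≤ finrank F (H ⧸ h)) :
    Nat.card {s : Fin i → H // LinearIndependent F (h.mkQ ∘ s)} =
      (∏ j : Fin i, (Fintype.card F ^ finrank F (H ⧸ h) - Fintype.card F ^ (j : ℕ))) *
        Fintype.card F ^ (finrank F h * i) := by
  have : Finite H := Module.finite_of_finite F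
  have : Finite (H ⧸ h) := Module.finite_of_finite F
  rw [Nat.card_congr (linearIndependentMkQEquiv h i), Nat.card_prod, card_linearIndependent hi,
    Nat.card_fun, Nat.card_fin, Module.natCard_eq_pow_finrank (K := F), Nat.card_eq_fintype_card,
    ← pow_mul]

/-- The vertex spanned by a tuple that is independent modulo `h`. -/
def spanVertex (h : Submodule F H) (i : ℕ)
    (s : {s : Fin i → H // LinearIndependent F (h.mkQ ∘ s)}) : {y : AttX h // vdim h y = i} :=
  ⟨⟨Submodule.span F (Set.range s.1), by
    have hd := Submodule.range_ker_disjoint s.2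
    rwa [Submodule.ker_mkQ, disjoint_iff] at hd⟩, by
    simp [vdim, finrank_span_eq_card (LinearIndependent.of_comp _ s.2)]⟩

/-- The tuples spanning a given vertex are the bases of that vertex. -/
def spanVertexFiberEquiv (h : Submodule F H) (i : ℕ) (y : {y : AttX h // vdim h y = i}) :
    {s // spanVertex h i s = y} ≃ {b : Fin i → y.1.1 // LinearIndependent F b} where
  toFun s := ⟨fun j => ⟨s.1.1 j, by
      have hs : Submodule.span F (Set.range s.1.1) = y.1.1 :=
        congrArg (fun z : {y : AttX h // vdim h y = i} => z.1.1) s.2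
      exact hs ▸ Submodule.subset_span (Set.mem_range_self j)⟩,
    LinearIndependent.of_comp y.1.1.subtype (LinearIndependent.of_comp h.mkQ s.1.2)⟩
  invFun b := ⟨⟨fun j => b.1 j, by
      have hd : Disjoint y.1.1 h := disjoint_iff.2 y.1.2
      refine b.2.map' (h.mkQ ∘ₗ y.1.1.subtype) ?_
      rw [LinearMap.ker_comp, Submodule.ker_mkQ]
      exact Submodule.disjoint_iff_comap_eq_bot.1 hd⟩, by
    apply Subtype.ext
    apply Subtype.ext
    change Submodule.span F (Set.range fun j => (b.1 j : H)) = y.1.1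
    apply Submodule.eq_of_le_of_finrank_eq
    · rw [Submodule.span_le]
      rintro _ ⟨j, rfl⟩
      exact (b.1 j).2
    · have hb := finrank_span_eq_card (b.2.map' y.1.1.subtype (Submodule.ker_subtype _))
      exact (hb.trans (Fintype.card_fin i)).trans y.2.symm⟩
  left_inv _ := rfl
  right_inv _ := rfl

theorem card_linearIndependent_mkQ_eq_card_vertex_mul (h : Submodule F H) (i : ℕ) :
    Nat.card {s : Fin i → H // LinearIndependent F (h.mkQ ∘ s)} =
      Nat.card {y : AttX h // vdim h y = i} *
        ∏ j : Fin i, (Fintype.card F ^ i - Fintype.card F ^ (j : ℕ)) := by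
  have : Finite H := Module.finite_of_finite F
  have hfib (y : {y : AttX h // vdim h y = i}) :
      Nat.card {s // spanVertex h i s = y} =
        ∏ j : Fin i, (Fintype.card F ^ i - Fintype.card F ^ (j : ℕ)) := by
    have hy : finrank F y.1.1 = i := y.2
    rw [Nat.card_congr (spanVertexFiberEquiv h i y), card_linearIndependent hy.ge, hy]
  rw [← Nat.card_congr (Equiv.sigmaFiberEquiv (spanVertex h i)), Nat.card_sigma,
    sum_congr rfl fun y _ => hfib y]
  simp

/-- the number of vertices of dimension `i` is `q^(M·i) binom(N,i)_q`. -/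
theorem stmt2 (q N M : ℕ) (hq : Fintype.card F = q) (hN : 0 < N) (hM : 0 < M)
    (h : Submodule F H) (hH : finrank F H = N + M) (hh : finrank F h = M)
    (i : ℕ) (hi : i ≤ N) :
    (Finset.univ.filter fun y : AttX h => vdim h y = i).card = q ^ (M * i) * qBinom q N i := by
  have hq1 : 1 < q := hq ▸ Fintype.one_lt_card
  have hquot : finrank F (H ⧸ h) = N := by
    have := h.finrank_quotient_add_finrank
    omega
  have hcount := (card_linearIndependent_mkQ_eq_card_vertex_mul h i).symm.trans
    (card_linearIndependent_mkQ h (hquot.symm ▸ hi))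
  rw [hquot, hh, hq] at hcount
  rw [← Fintype.card_subtype, ← Nat.card_eq_fintype_card]
  set c := Nat.card {y : AttX h // vdim h y = i}
  have hbases := prod_pow_sub_pow_mul_qFact q (le_refl i)
  rw [Nat.sub_self, qFact, mul_one] at hbases
  have hframes := prod_pow_sub_pow_mul_qFact q hi
  rw [hbases] at hcount
  have hpos : 0 < ∏ j ∈ range i, q ^ j * (q - 1) :=
    prod_pos fun j _ => Nat.mul_pos (pow_pos (by omega) _) (by omega)
  have hmul : c * (qFact q i * qFact q (N - i)) = q ^ (M * i) * qFact q N := by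
    apply Nat.eq_of_mul_eq_mul_left hpos
    linear_combination qFact q (N - i) * hcount + q ^ (M * i) * hframes
  have hcop : Nat.Coprime (qFact q i * qFact q (N - i)) (q ^ (M * i)) :=
    Nat.Coprime.pow_right _ ((coprime_qFact hq1 i).mul_left (coprime_qFact hq1 _))
  have hdvd : qFact q i * qFact q (N - i) ∣ qFact q N :=
    hcop.dvd_of_dvd_mul_left (hmul ▸ Dvd.intro_left c rfl)
  apply Nat.eq_of_mul_eq_mul_right (Nat.mul_pos (qFact_pos hq1 i) (qFact_pos hq1 (N - i)))
  rw [hmul, mul_assoc, qBinom, Nat.div_mul_cancel hdvd]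
end
end

section
/- The matrices R, L', A* satisfy: R A* = q A* R; L' A* = q^{−1} A* L'; (L')² R − (q+1) L' R L' + q R (L')² = −(q+1) q^{N+M} L' A*; and L' R² − (q+1) R L' R + q R² L' = −(q+1) q^{N+M} A* R. -/
open Module Matrix Finset

noncomputable section

open scoped Classical

variable {F H : Type} [Field F] [Fintype F] [AddCommGroup H] [Module F H]
  [FiniteDimensional F H]

/-- The raising matrix `R`: `(y,z)`-entry `1` if `y` covers `z`, else `0`. -/
def Rmat (h : Submodule F H) : Matrix (AttX h) (AttX h) ℂ :=
  fun y z => if AttCovers h z y then 1 else 0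

/-- The lowering matrix `L'`: `(y,z)`-entry `1` if `z` covers `y`, else `0`. -/
def Lpmat (h : Submodule F H) : Matrix (AttX h) (AttX h) ℂ :=
  fun y z => if AttCovers h y z then 1 else 0

/-- The `q`-lowering matrix `L`: `(y,z)`-entry `q^(dim y)` if `z` covers `y`, else `0`. -/
def Lmat (h : Submodule F H) (q : ℕ) : Matrix (AttX h) (AttX h) ℂ :=
  fun y z => if AttCovers h y z then (q : ℂ) ^ (vdim h y) else 0

/-- The `q`-adjacency matrix `A`: `(y,z)`-entry `1` if `y` covers `z`,
`q^(dim y)` if `z` covers `y`, and `0` otherwise. -/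
def Amat (h : Submodule F H) (q : ℕ) : Matrix (AttX h) (AttX h) ℂ :=
  fun y z =>
    if AttCovers h z y then 1 else if AttCovers h y z then (q : ℂ) ^ (vdim h y) else 0

/-- The dual adjacency matrix `A*`: diagonal with `(y,y)`-entry `q^{-dim y}`. -/
def Astar (h : Submodule F H) (q : ℕ) : Matrix (AttX h) (AttX h) ℂ :=
  Matrix.diagonal fun y => (q : ℂ) ^ (-(vdim h y : ℤ))

/-- The matrix `S`: diagonal with `(y,y)`-entry `(-1)^(dim y)`. -/
def Smat (h : Submodule F H) : Matrix (AttX h) (AttX h) ℂ :=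
  Matrix.diagonal fun y => (-1 : ℂ) ^ (vdim h y)

/-- The matrix `E*_i`: diagonal with `(y,y)`-entry `1` if `dim y = i`, else `0`. -/
def Estar (h : Submodule F H) (i : ℕ) : Matrix (AttX h) (AttX h) ℂ :=
  Matrix.diagonal fun y => if vdim h y = i then (1 : ℂ) else 0

omit [Fintype F] in
/-- A cover `a` of `y` is recovered from `y` and any vector of `a` outside `y`. -/
lemma AttCovers.eq_sup_span {h : Submodule F H} {y a : AttX h} (hya : AttCovers h y a) {v : H}
    (hva : v ∈ a.1) (hvy : v ∉ y.1) : a.1 = y.1 ⊔ Submodule.span F {v} := by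
  symm
  apply Submodule.eq_of_le_of_finrank_le
  · exact sup_le hya.1 ((Submodule.span_singleton_le_iff_mem _ _).2 hva)
  · have hlt : y.1 < y.1 ⊔ Submodule.span F {v} := by
      refine lt_of_le_of_ne le_sup_left fun e => hvy ?_
      rw [e]
      exact Submodule.mem_sup_right (Submodule.mem_span_singleton_self v)
    have := Submodule.finrank_lt_finrank_of_lt hlt
    have := hya.2
    unfold vdim at this
    omega

omit [Fintype F] in
/-- Adjoining a vector outside `y ⊔ h` to a vertex `y` gives a vertex covering `y`. -/
lemma exists_attCovers_of_notMem {h : Submodule F H} (y : AttX h) {v : H} (hv : v ∉ y.1 ⊔ h) :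
    ∃ a : AttX h, AttCovers h y a ∧ a.1 = y.1 ⊔ Submodule.span F {v} := by
  have hvy : v ∉ y.1 := fun hy => hv (Submodule.mem_sup_left hy)
  refine ⟨⟨y.1 ⊔ Submodule.span F {v}, ?_⟩, ⟨le_sup_left, ?_⟩, rfl⟩
  · rw [Submodule.eq_bot_iff]
    rintro w ⟨hw, hwh⟩
    obtain ⟨u, hu, s, hs, rfl⟩ := Submodule.mem_sup.1 hw
    obtain ⟨c, rfl⟩ := Submodule.mem_span_singleton.1 hs
    have hc : c = 0 := by
      by_contra hc
      apply hv
      have : v = c⁻¹ • (-u + (u + c • v)) := by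
        rw [neg_add_cancel_left, inv_smul_smul₀ hc]
      rw [this]
      exact Submodule.smul_mem _ _ (Submodule.add_mem _
        (Submodule.mem_sup_left (Submodule.neg_mem _ hu)) (Submodule.mem_sup_right hwh))
    subst hc
    have : u + (0 : F) • v ∈ y.1 ⊓ h := ⟨by simpa using hu, hwh⟩
    rwa [y.2, Submodule.mem_bot] at this
  · have hv0 : v ≠ 0 := fun e => hvy (e ▸ Submodule.zero_mem _)
    have h1 := Submodule.finrank_sup_add_finrank_inf_eq y.1 (Submodule.span F {v})
    have h2 : y.1 ⊓ Submodule.span F {v} = ⊥ :=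
      disjoint_iff.1 ((Submodule.disjoint_span_singleton' hv0).2 hvy)
    rw [h2, finrank_bot, finrank_span_singleton hv0] at h1
    exact h1

omit [FiniteDimensional F H] in
lemma card_filter_mem_notMem [Fintype H] (A B : Submodule F H) :
    #{v : H | v ∈ A ∧ v ∉ B} + Fintype.card F ^ finrank F ↥(A ⊓ B)
      = Fintype.card F ^ finrank F A := by
  have hc (C : Submodule F H) : #{v : H | v ∈ C} = Fintype.card F ^ finrank F C := by
    rw [← Module.card_eq_pow_finrank (K := F) (V := C), Fintype.card_subtype]
  rw [← hc, ← hc, ← Finset.card_filter_add_card_filter_not (s := {v : H | v ∈ A}) (· ∈ B),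
    Finset.filter_filter, Finset.filter_filter, add_comm]
  simp only [Submodule.mem_inf]

/-- The number of vertices covering `y` inside a subspace `W`, counted through vectors. -/
lemma card_attCovers_le_mul {h : Submodule F H} (y : AttX h) (W : Submodule F H) (hW : y.1 ≤ W) :
    (#{a : AttX h | AttCovers h y a ∧ a.1 ≤ W} : ℂ)
        * ((Fintype.card F : ℂ) ^ (vdim h y) * ((Fintype.card F : ℂ) - 1))
      = (Fintype.card F : ℂ) ^ finrank F W
        - (Fintype.card F : ℂ) ^ finrank F ↥(W ⊓ (y.1 ⊔ h)) := by
  have : Finite H := Module.finite_of_finite F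
  have := Fintype.ofFinite H
  have hT : ({v : H | v ∈ W ∧ v ∉ y.1 ⊔ h} : Finset H)
      = ({a : AttX h | AttCovers h y a ∧ a.1 ≤ W} : Finset (AttX h)).biUnion
        (fun a => {v : H | v ∈ a.1 ∧ v ∉ y.1}) := by
    ext v
    simp only [Finset.mem_filter, Finset.mem_univ, true_and, Finset.mem_biUnion]
    constructor
    · rintro ⟨hvW, hv⟩
      obtain ⟨a, hya, ha⟩ := exists_attCovers_of_notMem y hv
      refine ⟨a, ⟨hya, ?_⟩, ?_, fun hy => hv (Submodule.mem_sup_left hy)⟩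
      · rw [ha]
        exact sup_le hW ((Submodule.span_singleton_le_iff_mem _ _).2 hvW)
      · rw [ha]
        exact Submodule.mem_sup_right (Submodule.mem_span_singleton_self v)
    · rintro ⟨a, ⟨hya, haW⟩, hva, hvy⟩
      refine ⟨haW hva, fun hv => hvy ?_⟩
      obtain ⟨u, hu, w, hw, rfl⟩ := Submodule.mem_sup.1 hv
      have hwa : w ∈ a.1 ⊓ h := ⟨by simpa using a.1.sub_mem hva (hya.1 hu), hw⟩
      rw [a.2, Submodule.mem_bot] at hwa
      simpa [hwa] using hu
  have hcard := congrArg Finset.card hT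
  rw [Finset.card_biUnion] at hcard
  · have h1 := card_filter_mem_notMem W (y.1 ⊔ h)
    have h2 : ∀ a ∈ ({a : AttX h | AttCovers h y a ∧ a.1 ≤ W} : Finset (AttX h)),
        ((#{v : H | v ∈ a.1 ∧ v ∉ y.1} : ℕ) : ℂ)
          = (Fintype.card F : ℂ) ^ (vdim h y) * ((Fintype.card F : ℂ) - 1) := by
      intro a ha
      simp only [Finset.mem_filter, Finset.mem_univ, true_and] at ha
      have h3 := card_filter_mem_notMem a.1 y.1
      have h4 := ha.1.2
      unfold vdim at h4 ⊢
      rw [inf_eq_right.2 ha.1.1, h4] at h3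
      have h5 := congrArg (Nat.cast : ℕ → ℂ) h3
      push_cast at h5
      linear_combination h5
    have h6 := congrArg (Nat.cast : ℕ → ℂ) h1
    have h7 := congrArg (Nat.cast : ℕ → ℂ) hcard
    push_cast at h6 h7
    rw [Finset.sum_congr rfl h2, Finset.sum_const, nsmul_eq_mul] at h7
    linear_combination h6 - h7
  · intro a ha b hb hab
    simp only [Finset.coe_filter, Finset.mem_univ, true_and, Set.mem_ofPred_eq] at ha hb
    refine Finset.disjoint_left.2 fun v hva hvb => hab ?_
    simp only [Finset.mem_filter, Finset.mem_univ, true_and] at hva hvb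
    exact Subtype.ext ((ha.1.eq_sup_span hva.1 hva.2).trans (hb.1.eq_sup_span hvb.1 hvb.2).symm)

lemma Lpmat_mul_apply {h : Submodule F H} (K : Matrix (AttX h) (AttX h) ℂ) (y z : AttX h) :
    (Lpmat h * K) y z = ∑ a with AttCovers h y a, K a z := by
  simp only [Matrix.mul_apply, Lpmat, ite_mul, one_mul, zero_mul]
  rw [Finset.sum_filter]

lemma mul_Lpmat_apply {h : Submodule F H} (K : Matrix (AttX h) (AttX h) ℂ) (y z : AttX h) :
    (K * Lpmat h) y z = ∑ b with AttCovers h b z, K y b := by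
  simp only [Matrix.mul_apply, Lpmat, mul_ite, mul_one, mul_zero]
  rw [Finset.sum_filter]

lemma Lpmat_mul_Rmat_apply (h : Submodule F H) (y z : AttX h) :
    (Lpmat h * Rmat h) y z = #{b : AttX h | AttCovers h y b ∧ AttCovers h z b} := by
  rw [Lpmat_mul_apply]
  simp only [Rmat]
  rw [Finset.sum_boole, Finset.filter_filter]

lemma Rmat_mul_Lpmat_apply (h : Submodule F H) (y z : AttX h) :
    (Rmat h * Lpmat h) y z = #{b : AttX h | AttCovers h b y ∧ AttCovers h b z} := by
  rw [mul_Lpmat_apply]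
  simp only [Rmat]
  rw [Finset.sum_boole, Finset.filter_filter]
  simp only [and_comm]

omit [Fintype F] in
lemma vdim_sup_add_vdim_inf {h : Submodule F H} (y z : AttX h) :
    finrank F ↥(y.1 ⊔ z.1) + finrank F ↥(y.1 ⊓ z.1) = vdim h y + vdim h z :=
  Submodule.finrank_sup_add_finrank_inf_eq _ _

omit [Fintype F] in
lemma AttX.eq_of_le {h : Submodule F H} {y z : AttX h} (hyz : y.1 ≤ z.1)
    (hd : vdim h z ≤ vdim h y) : y = z :=
  Subtype.ext (Submodule.eq_of_le_of_finrank_le hyz hd)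

omit [Fintype F] in
lemma vdim_lt_finrank_sup {h : Submodule F H} {y z : AttX h} (hne : y ≠ z)
    (hd : vdim h y = vdim h z) : vdim h y < finrank F ↥(y.1 ⊔ z.1) := by
  by_contra hlt
  have h1 : y.1 = y.1 ⊔ z.1 := Submodule.eq_of_le_of_finrank_le le_sup_left (not_lt.1 hlt)
  exact hne (AttX.eq_of_le (h1 ▸ le_sup_right) hd.le).symm

omit [Fintype F] in
lemma AttCovers.eq_sup {h : Submodule F H} {y z b : AttX h} (hyb : AttCovers h y b)
    (hzb : AttCovers h z b) (hne : y ≠ z) : b.1 = y.1 ⊔ z.1 := by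
  have h1 := hyb.2
  have h2 := hzb.2
  have h3 := vdim_lt_finrank_sup hne (by omega)
  refine (Submodule.eq_of_le_of_finrank_le (sup_le hyb.1 hzb.1) ?_).symm
  change vdim h b ≤ _
  omega

omit [Fintype F] in
lemma AttCovers.eq_inf {h : Submodule F H} {y z c : AttX h} (hcy : AttCovers h c y)
    (hcz : AttCovers h c z) (hne : y ≠ z) : c.1 = y.1 ⊓ z.1 := by
  have h1 := hcy.2
  have h2 := hcz.2
  have h3 := vdim_lt_finrank_sup hne (by omega)
  have h4 := vdim_sup_add_vdim_inf y z
  refine Submodule.eq_of_le_of_finrank_le (le_inf hcy.1 hcz.1) ?_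
  change _ ≤ vdim h c
  omega

lemma Rmat_mul_Lpmat_apply_of_ne {h : Submodule F H} {y z : AttX h} (hne : y ≠ z)
    (hd : vdim h y = vdim h z) :
    (Rmat h * Lpmat h) y z = if finrank F ↥(y.1 ⊔ z.1) = vdim h y + 1 then 1 else 0 := by
  rw [Rmat_mul_Lpmat_apply]
  have h4 := vdim_sup_add_vdim_inf y z
  split_ifs with hs
  · rw [Nat.cast_eq_one, Finset.card_eq_one]
    let c : AttX h := ⟨y.1 ⊓ z.1, by rw [inf_right_comm, y.2, bot_inf_eq]⟩
    have hc : vdim h c + 1 = vdim h y := by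
      change finrank F ↥(y.1 ⊓ z.1) + 1 = _
      omega
    refine ⟨c, Finset.ext fun b => ?_⟩
    simp only [Finset.mem_filter, Finset.mem_univ, true_and, Finset.mem_singleton]
    constructor
    · rintro ⟨h1, h2⟩
      exact Subtype.ext (h1.eq_inf h2 hne)
    · rintro rfl
      exact ⟨⟨inf_le_left, hc.symm⟩, ⟨inf_le_right, hd ▸ hc.symm⟩⟩
  · rw [Nat.cast_eq_zero, Finset.card_eq_zero, Finset.filter_eq_empty_iff]
    rintro b - ⟨h1, h2⟩
    apply hs
    have h3 := h1.2
    have h5 : vdim h b = finrank F ↥(y.1 ⊓ z.1) := by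
      rw [← h1.eq_inf h2 hne]
      rfl
    omega

lemma Lpmat_mul_Rmat_apply_of_ne {h : Submodule F H} {y z : AttX h} (hne : y ≠ z)
    (hd : vdim h y = vdim h z) :
    (Lpmat h * Rmat h) y z =
      if finrank F ↥(y.1 ⊔ z.1) = vdim h y + 1 ∧ (y.1 ⊔ z.1) ⊓ h = ⊥ then 1 else 0 := by
  rw [Lpmat_mul_Rmat_apply]
  split_ifs with hs
  · rw [Nat.cast_eq_one, Finset.card_eq_one]
    let c : AttX h := ⟨y.1 ⊔ z.1, hs.2⟩
    refine ⟨c, Finset.ext fun b => ?_⟩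
    simp only [Finset.mem_filter, Finset.mem_univ, true_and, Finset.mem_singleton]
    constructor
    · rintro ⟨h1, h2⟩
      exact Subtype.ext (h1.eq_sup h2 hne)
    · rintro rfl
      exact ⟨⟨le_sup_left, hs.1⟩, ⟨le_sup_right, hd ▸ hs.1⟩⟩
  · rw [Nat.cast_eq_zero, Finset.card_eq_zero, Finset.filter_eq_empty_iff]
    rintro b - ⟨h1, h2⟩
    apply hs
    rw [← h1.eq_sup h2 hne]
    exact ⟨h1.2, b.2⟩

/-- The commutator of `L'` and `R`. -/
def commLR (h : Submodule F H) : Matrix (AttX h) (AttX h) ℂ :=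
  Lpmat h * Rmat h - Rmat h * Lpmat h

lemma commLR_apply_of_ne {h : Submodule F H} {y z : AttX h} (hne : y ≠ z)
    (hd : vdim h y = vdim h z) :
    commLR h y z =
      if finrank F ↥(y.1 ⊔ z.1) = vdim h y + 1 ∧ (y.1 ⊔ z.1) ⊓ h ≠ ⊥ then -1 else 0 := by
  rw [commLR, Matrix.sub_apply, Lpmat_mul_Rmat_apply_of_ne hne hd,
    Rmat_mul_Lpmat_apply_of_ne hne hd]
  split_ifs <;> simp_all

lemma commLR_apply_of_vdim_ne {h : Submodule F H} {y z : AttX h} (hd : vdim h y ≠ vdim h z) :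
    commLR h y z = 0 := by
  rw [commLR, Matrix.sub_apply, Lpmat_mul_Rmat_apply, Rmat_mul_Lpmat_apply,
    Finset.filter_false_of_mem, Finset.filter_false_of_mem]
  · simp
  · rintro b - ⟨h1, h2⟩
    exact hd (h1.2.trans h2.2.symm)
  · rintro b - ⟨h1, h2⟩
    exact hd (Nat.succ_injective (h1.2.symm.trans h2.2))

lemma one_lt_card_cast : (Fintype.card F : ℂ) ≠ 0 ∧ (Fintype.card F : ℂ) - 1 ≠ 0 := by
  have := Fintype.one_lt_card (α := F)
  refine ⟨by exact_mod_cast (by omega : Fintype.card F ≠ 0), ?_⟩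
  rw [sub_ne_zero]
  exact_mod_cast this.ne'

/-- The interval of length two between vertices has `q + 1` middle elements. -/
lemma card_attCovers_le_of_le {h : Submodule F H} {c z : AttX h} (hcz : c.1 ≤ z.1)
    (hd : vdim h z = vdim h c + 2) :
    (#{b : AttX h | AttCovers h c b ∧ b.1 ≤ z.1} : ℂ) = Fintype.card F + 1 := by
  have h1 := card_attCovers_le_mul c z.1 hcz
  have h2 : z.1 ⊓ (c.1 ⊔ h) = c.1 := by
    rw [inf_comm, sup_inf_assoc_of_le h hcz, inf_comm h, z.2, sup_bot_eq]
  rw [h2] at h1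
  change _ = (Fintype.card F : ℂ) ^ vdim h z - (Fintype.card F : ℂ) ^ vdim h c at h1
  obtain ⟨h3, h4⟩ := one_lt_card_cast (F := F)
  rw [hd] at h1
  refine mul_right_cancel₀ (mul_ne_zero (pow_ne_zero (vdim h c) h3) h4) (h1.trans ?_)
  ring

/-- The numbers of vertices covered by `y` and by a cover `z` of `y` are related. -/
lemma Rmat_mul_Lpmat_apply_self {h : Submodule F H} {y z : AttX h} (hyz : AttCovers h y z) :
    (Rmat h * Lpmat h) z z = 1 + Fintype.card F * (Rmat h * Lpmat h) y y := by
  have hdiag (x : AttX h) : (Rmat h * Lpmat h) x x = #{b : AttX h | AttCovers h b x} := by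
    simp [Rmat_mul_Lpmat_apply]
  have e1 : (Rmat h * (Lpmat h * Lpmat h)) y z
      = (Rmat h * Lpmat h) y y * (Fintype.card F + 1) := by
    simp only [Matrix.mul_apply (M := Rmat h) (N := Lpmat h * Lpmat h), Rmat, ite_mul, one_mul,
      zero_mul]
    rw [← Finset.sum_filter, hdiag, ← nsmul_eq_mul]
    refine Finset.sum_eq_card_nsmul fun c hc => ?_
    simp only [Finset.mem_filter, Finset.mem_univ, true_and] at hc
    have h1 := hc.2
    have h2 := hyz.2
    rw [← card_attCovers_le_of_le (hc.1.trans hyz.1) (by omega), Lpmat_mul_apply]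
    simp only [Lpmat]
    rw [Finset.sum_boole, Finset.filter_filter]
    congr 2
    ext b
    simp only [Finset.mem_filter, Finset.mem_univ, true_and]
    refine and_congr_right fun hb => ⟨fun hbz => hbz.1, fun hbz => ⟨hbz, ?_⟩⟩
    have := hb.2
    omega
  have e2 : (Rmat h * Lpmat h * Lpmat h) y z
      = (Rmat h * Lpmat h) y y + ((Rmat h * Lpmat h) z z - 1) := by
    have hy : y ∈ ({b : AttX h | AttCovers h b z} : Finset (AttX h)) := by simpa using hyz
    rw [mul_Lpmat_apply, ← Finset.add_sum_erase _ _ hy, hdiag z,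
      ← Finset.card_erase_add_one hy, Nat.cast_add, Nat.cast_one, add_sub_cancel_right,
      ← mul_one (Nat.cast _), ← nsmul_eq_mul]
    congr 1
    refine Finset.sum_eq_card_nsmul fun b hb => ?_
    simp only [Finset.mem_erase, Finset.mem_filter, Finset.mem_univ, true_and] at hb
    have h1 := hyz.2
    have h2 := hb.2.2
    rw [Rmat_mul_Lpmat_apply_of_ne hb.1.symm (by omega), if_pos]
    rw [← hyz.eq_sup hb.2 hb.1.symm]
    exact h1
  rw [← Matrix.mul_assoc, e2] at e1
  linear_combination e1

omit [Fintype F] in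
lemma finrank_sup_of_vertex {h : Submodule F H} (y : AttX h) :
    finrank F ↥(y.1 ⊔ h) = vdim h y + finrank F h := by
  have h1 := Submodule.finrank_sup_add_finrank_inf_eq y.1 h
  rwa [y.2, finrank_bot, add_zero] at h1

/-- The number of vertices covering a given vertex. -/
lemma Lpmat_mul_Rmat_apply_self {h : Submodule F H} (y : AttX h) :
    (Lpmat h * Rmat h) y y
        * ((Fintype.card F : ℂ) ^ (vdim h y) * ((Fintype.card F : ℂ) - 1))
      = (Fintype.card F : ℂ) ^ finrank F H
        - (Fintype.card F : ℂ) ^ (vdim h y + finrank F h) := by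
  have h1 := card_attCovers_le_mul y ⊤ le_top
  rw [top_inf_eq, finrank_top, finrank_sup_of_vertex] at h1
  rw [← h1, Lpmat_mul_Rmat_apply]
  simp

lemma commLR_apply_self_sub {h : Submodule F H} {y z : AttX h} (hyz : AttCovers h y z) :
    commLR h z z - Fintype.card F * commLR h y y
      = (Fintype.card F : ℂ) ^ finrank F h - 1
        - (Fintype.card F + 1) * (Fintype.card F : ℂ) ^ finrank F H
          * (Fintype.card F : ℂ) ^ (-(vdim h z : ℤ)) := by
  obtain ⟨h3, h4⟩ := one_lt_card_cast (F := F)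
  have hy := Lpmat_mul_Rmat_apply_self y
  have hz := Lpmat_mul_Rmat_apply_self z
  have hl := Rmat_mul_Lpmat_apply_self hyz
  simp only [commLR, Matrix.sub_apply]
  rw [hyz.2] at hz ⊢
  rw [_root_.zpow_neg, zpow_natCast]
  refine mul_right_cancel₀ (mul_ne_zero (pow_ne_zero (vdim h y + 1) h3) h4) ?_
  have h5 : ((Fintype.card F : ℂ) ^ (vdim h y + 1))⁻¹ * (Fintype.card F : ℂ) ^ (vdim h y + 1) = 1 :=
    inv_mul_cancel₀ (pow_ne_zero _ h3)
  linear_combination hz - (Fintype.card F : ℂ) ^ 2 * hy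
    - (Fintype.card F : ℂ) ^ (vdim h y + 1) * ((Fintype.card F : ℂ) - 1) * hl
    + (Fintype.card F + 1) * (Fintype.card F : ℂ) ^ finrank F H * ((Fintype.card F : ℂ) - 1) * h5

/-- The number of vertices covering `y` inside `z ⊔ h`, where `z` covers `y`. -/
lemma card_attCovers_le_sup {h : Submodule F H} {y z : AttX h} (hyz : AttCovers h y z) :
    (#{a : AttX h | AttCovers h y a ∧ a.1 ≤ z.1 ⊔ h} : ℂ)
      = (Fintype.card F : ℂ) ^ finrank F h := by
  obtain ⟨h3, h4⟩ := one_lt_card_cast (F := F)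
  have h1 := card_attCovers_le_mul y (z.1 ⊔ h) (hyz.1.trans le_sup_left)
  rw [inf_eq_right.2 (sup_le_sup_right hyz.1 h), finrank_sup_of_vertex, finrank_sup_of_vertex,
    hyz.2] at h1
  refine mul_right_cancel₀ (mul_ne_zero (pow_ne_zero (vdim h y) h3) h4) (h1.trans ?_)
  ring

omit [Fintype F] in
lemma sup_inf_ne_bot_iff {h : Submodule F H} {y z a : AttX h} (hyz : AttCovers h y z)
    (hya : AttCovers h y a) (hne : a ≠ z) : (a.1 ⊔ z.1) ⊓ h ≠ ⊥ ↔ a.1 ≤ z.1 ⊔ h := by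
  have h1 := hyz.2
  have h2 := hya.2
  constructor
  · intro hb
    obtain ⟨u, ⟨hu, huh⟩, hu0⟩ := Submodule.exists_mem_ne_zero_of_ne_bot hb
    obtain ⟨s, hs, t, ht, rfl⟩ := Submodule.mem_sup.1 hu
    have hsz : s ∉ z.1 := fun hsz => hu0 <| by
      have : s + t ∈ z.1 ⊓ h := ⟨z.1.add_mem hsz ht, huh⟩
      rwa [z.2, Submodule.mem_bot] at this
    rw [hya.eq_sup_span hs fun hsy => hsz (hyz.1 hsy)]
    refine sup_le (hyz.1.trans le_sup_left) ((Submodule.span_singleton_le_iff_mem _ _).2 ?_)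
    rw [← add_sub_cancel_right s t]
    exact Submodule.sub_mem _ (Submodule.mem_sup_right huh) (Submodule.mem_sup_left ht)
  · intro hle hb
    apply hne
    have h3 : a.1 ⊔ z.1 = z.1 := by
      calc a.1 ⊔ z.1 = (a.1 ⊔ z.1) ⊓ (z.1 ⊔ h) :=
            (inf_eq_left.2 (sup_le hle le_sup_left)).symm
        _ = z.1 ⊔ h ⊓ (a.1 ⊔ z.1) := by rw [inf_comm, sup_inf_assoc_of_le h le_sup_right]
        _ = z.1 := by rw [inf_comm, hb, sup_bot_eq]
    exact AttX.eq_of_le (sup_eq_right.1 h3) (by omega)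

lemma Lpmat_mul_commLR_apply_of_attCovers {h : Submodule F H} {y z : AttX h}
    (hyz : AttCovers h y z) :
    (Lpmat h * commLR h) y z
      = commLR h z z - ((Fintype.card F : ℂ) ^ finrank F h - 1) := by
  have hz : z ∈ ({a : AttX h | AttCovers h y a ∧ a.1 ≤ z.1 ⊔ h} : Finset (AttX h)) := by
    simpa using hyz
  have hz' : z ∈ ({a : AttX h | AttCovers h y a} : Finset (AttX h)) := by simpa using hyz
  rw [Lpmat_mul_apply, ← Finset.add_sum_erase _ _ hz', ← card_attCovers_le_sup hyz,
    ← Finset.card_erase_add_one hz, Nat.cast_add, Nat.cast_one, add_sub_cancel_right,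
    sub_eq_add_neg, ← mul_neg_one (Nat.cast _), ← nsmul_eq_mul, ← Finset.sum_const]
  congr 1
  rw [← Finset.filter_filter, ← Finset.filter_erase (p := fun a : AttX h => a.1 ≤ z.1 ⊔ h),
    Finset.sum_filter (p := fun a : AttX h => a.1 ≤ z.1 ⊔ h)]
  refine Finset.sum_congr rfl fun a ha => ?_
  simp only [Finset.mem_erase, Finset.mem_filter, Finset.mem_univ, true_and] at ha
  have h1 := hyz.2
  have h2 := ha.2.2
  rw [commLR_apply_of_ne ha.1 (by omega)]
  refine if_congr ?_ rfl rfl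
  rw [sup_inf_ne_bot_iff hyz ha.2 ha.1, and_iff_right]
  have h3 := vdim_lt_finrank_sup ha.1 (by omega)
  have h4 := vdim_sup_add_vdim_inf a z
  have h5 : vdim h y ≤ finrank F ↥(a.1 ⊓ z.1) :=
    Submodule.finrank_mono (le_inf ha.2.1 hyz.1)
  omega

lemma commLR_mul_Lpmat_apply_of_attCovers {h : Submodule F H} {y z : AttX h}
    (hyz : AttCovers h y z) : (commLR h * Lpmat h) y z = commLR h y y := by
  rw [mul_Lpmat_apply, Finset.sum_eq_single_of_mem y (by simpa using hyz)]
  intro b hb hne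
  simp only [Finset.mem_filter, Finset.mem_univ, true_and] at hb
  have h1 := hyz.2
  have h2 := hb.2
  rw [commLR_apply_of_ne hne.symm (by omega), if_neg]
  rintro ⟨-, h3⟩
  rw [← hyz.eq_sup hb hne.symm] at h3
  exact h3 z.2

omit [Fintype F] in
/-- When `y ⊔ z` has dimension one more than `z`, its intersection with `h` is at most a line. -/
lemma finrank_sup_inf_eq_one {h : Submodule F H} {y z : AttX h}
    (hs : finrank F ↥(y.1 ⊔ z.1) = vdim h z + 1) (hb : (y.1 ⊔ z.1) ⊓ h ≠ ⊥) :
    finrank F ↥((y.1 ⊔ z.1) ⊓ h) = 1 := by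
  have h1 := Submodule.finrank_sup_add_finrank_inf_eq z.1 ((y.1 ⊔ z.1) ⊓ h)
  have h2 : z.1 ⊓ ((y.1 ⊔ z.1) ⊓ h) = ⊥ := by rw [inf_left_comm, z.2, inf_bot_eq]
  have h3 : finrank F ↥(z.1 ⊔ (y.1 ⊔ z.1) ⊓ h) ≤ finrank F ↥(y.1 ⊔ z.1) :=
    Submodule.finrank_mono (sup_le le_sup_right inf_le_left)
  have h4 := Submodule.one_le_finrank_iff.2 hb
  rw [h2, finrank_bot] at h1
  unfold vdim at hs
  omega

omit [Fintype F] in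
lemma finrank_sup_inf_sup {h : Submodule F H} {y z : AttX h}
    (hs : finrank F ↥(y.1 ⊔ z.1) = vdim h z + 1) (hb : (y.1 ⊔ z.1) ⊓ h ≠ ⊥) :
    finrank F ↥(y.1 ⊔ (y.1 ⊔ z.1) ⊓ h) = vdim h y + 1 := by
  have h1 := Submodule.finrank_sup_add_finrank_inf_eq y.1 ((y.1 ⊔ z.1) ⊓ h)
  have h2 : y.1 ⊓ ((y.1 ⊔ z.1) ⊓ h) = ⊥ := by rw [inf_left_comm, y.2, inf_bot_eq]
  rw [h2, finrank_bot, finrank_sup_inf_eq_one hs hb] at h1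
  exact h1

lemma Lpmat_mul_commLR_apply_of_not_le {h : Submodule F H} {y z : AttX h}
    (hd : vdim h z = vdim h y + 1) (hyz : ¬ y.1 ≤ z.1) :
    (Lpmat h * commLR h) y z =
      if finrank F ↥(y.1 ⊔ z.1) = vdim h z + 1 ∧ (y.1 ⊔ z.1) ⊓ h ≠ ⊥
        then -(Fintype.card F : ℂ) else 0 := by
  have hlt : vdim h z < finrank F ↥(y.1 ⊔ z.1) :=
    Submodule.finrank_lt_finrank_of_lt (lt_of_le_of_ne le_sup_right
      fun e => hyz (e ▸ le_sup_left))
  have hac {a : AttX h} (hya : AttCovers h y a) :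
      commLR h a z = if finrank F ↥(a.1 ⊔ z.1) = vdim h a + 1 ∧ (a.1 ⊔ z.1) ⊓ h ≠ ⊥
        then -1 else 0 := by
    refine commLR_apply_of_ne ?_ (hya.2.trans hd.symm)
    rintro rfl
    exact hyz hya.1
  have heq {a : AttX h} (hya : AttCovers h y a)
      (hs : finrank F ↥(a.1 ⊔ z.1) = vdim h a + 1) : y.1 ⊔ z.1 = a.1 ⊔ z.1 := by
    refine Submodule.eq_of_le_of_finrank_le (sup_le_sup_right hya.1 _) ?_
    have := hya.2
    omega
  rw [Lpmat_mul_apply]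
  split_ifs with hs
  · obtain ⟨h3, h4⟩ := one_lt_card_cast (F := F)
    have h1 := card_attCovers_le_mul y (y.1 ⊔ z.1) le_sup_left
    rw [inf_comm, sup_inf_assoc_of_le h le_sup_left, inf_comm h, finrank_sup_inf_sup hs.1 hs.2,
      hs.1, hd] at h1
    have h2 : (#{a : AttX h | AttCovers h y a ∧ a.1 ≤ y.1 ⊔ z.1} : ℂ) = Fintype.card F := by
      refine mul_right_cancel₀ (mul_ne_zero (pow_ne_zero (vdim h y) h3) h4) (h1.trans ?_)
      ring
    rw [← h2, ← mul_neg_one (Nat.cast _), ← nsmul_eq_mul, ← Finset.sum_const,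
      ← Finset.filter_filter, Finset.sum_filter (p := fun a : AttX h => a.1 ≤ y.1 ⊔ z.1)]
    refine Finset.sum_congr rfl fun a ha => ?_
    simp only [Finset.mem_filter, Finset.mem_univ, true_and] at ha
    rw [hac ha]
    refine if_congr ⟨fun ⟨h5, _⟩ => ?_, fun h5 => ?_⟩ rfl rfl
    · rw [heq ha h5]
      exact le_sup_left
    · have h6 : a.1 ⊔ z.1 = y.1 ⊔ z.1 :=
        le_antisymm (sup_le h5 le_sup_right) (sup_le_sup_right ha.1 _)
      rw [h6, ha.2, ← hd]
      exact hs
  · refine Finset.sum_eq_zero fun a ha => ?_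
    simp only [Finset.mem_filter, Finset.mem_univ, true_and] at ha
    rw [hac ha, if_neg]
    rintro ⟨h5, h6⟩
    have h7 := heq ha h5
    rw [← h7, ha.2, ← hd] at h5
    rw [← h7] at h6
    exact hs ⟨h5, h6⟩

lemma commLR_mul_Lpmat_apply_of_not_le {h : Submodule F H} {y z : AttX h}
    (hd : vdim h z = vdim h y + 1) (hyz : ¬ y.1 ≤ z.1) :
    (commLR h * Lpmat h) y z =
      if finrank F ↥(y.1 ⊔ z.1) = vdim h z + 1 ∧ (y.1 ⊔ z.1) ⊓ h ≠ ⊥ then -1 else 0 := by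
  have hne {b : AttX h} (hbz : AttCovers h b z) : y ≠ b := by
    rintro rfl
    exact hyz hbz.1
  have hdb {b : AttX h} (hbz : AttCovers h b z) : vdim h y = vdim h b := by
    have := hbz.2
    omega
  have hdim {b : AttX h} (hbz : AttCovers h b z)
      (hs : finrank F ↥(y.1 ⊔ b.1) = vdim h y + 1) :
      finrank F ↥(y.1 ⊔ z.1) = vdim h z + 1 := by
    have h1 := Submodule.finrank_sup_add_finrank_inf_eq (y.1 ⊔ b.1) z.1
    have h2 : vdim h b ≤ finrank F ↥((y.1 ⊔ b.1) ⊓ z.1) :=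
      Submodule.finrank_mono (le_inf le_sup_right hbz.1)
    rw [sup_assoc, sup_eq_right.2 hbz.1] at h1
    have h3 := hdb hbz
    have hlt : finrank F ↥z.1 < finrank F ↥(y.1 ⊔ z.1) :=
      Submodule.finrank_lt_finrank_of_lt (lt_of_le_of_ne le_sup_right
        fun e => hyz (e ▸ le_sup_left))
    unfold vdim at *
    omega
  rw [mul_Lpmat_apply]
  split_ifs with hs
  · set P := y.1 ⊔ (y.1 ⊔ z.1) ⊓ h
    have hPd : finrank F P = vdim h y + 1 := finrank_sup_inf_sup hs.1 hs.2
    have hPz : P ⊔ z.1 = y.1 ⊔ z.1 :=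
      le_antisymm (sup_le (sup_le le_sup_left inf_le_left) le_sup_right)
        (sup_le_sup_right le_sup_left _)
    let b : AttX h := ⟨P ⊓ z.1, by rw [inf_assoc, z.2, inf_bot_eq]⟩
    have hbd : vdim h b = vdim h y := by
      have h1 := Submodule.finrank_sup_add_finrank_inf_eq P z.1
      rw [hPz, hs.1, hPd] at h1
      change finrank F ↥(P ⊓ z.1) = _
      unfold vdim at *
      omega
    have hbz : AttCovers h b z := ⟨inf_le_right, by rw [hd, hbd]⟩
    have hbP : y.1 ⊔ b.1 = P := by
      refine Submodule.eq_of_le_of_finrank_le (sup_le le_sup_left inf_le_left) ?_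
      have := vdim_lt_finrank_sup (hne hbz) hbd.symm
      omega
    rw [Finset.sum_eq_single_of_mem b (by simpa using hbz)]
    · rw [commLR_apply_of_ne (hne hbz) hbd.symm, if_pos]
      rw [hbP]
      exact ⟨hPd, fun e => hs.2 (eq_bot_mono (le_inf le_sup_right inf_le_right) e)⟩
    · intro c hc hcb
      simp only [Finset.mem_filter, Finset.mem_univ, true_and] at hc
      rw [commLR_apply_of_ne (hne hc) (hdb hc), if_neg]
      rintro ⟨h1, h2⟩
      apply hcb
      have h3 : (y.1 ⊔ c.1) ⊓ h = (y.1 ⊔ z.1) ⊓ h := by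
        refine Submodule.eq_of_le_of_finrank_le
          (inf_le_inf_right h (sup_le_sup_left hc.1 _)) ?_
        rw [finrank_sup_inf_eq_one hs.1 hs.2]
        exact Submodule.one_le_finrank_iff.2 h2
      have h4 : P = y.1 ⊔ c.1 := by
        refine Submodule.eq_of_le_of_finrank_le (sup_le le_sup_left ?_) (by omega)
        rw [← h3]
        exact inf_le_left
      refine AttX.eq_of_le (le_inf ?_ hc.1) (by rw [hbd, hdb hc])
      rw [h4]
      exact le_sup_right
  · refine Finset.sum_eq_zero fun b hb => ?_
    simp only [Finset.mem_filter, Finset.mem_univ, true_and] at hb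
    rw [commLR_apply_of_ne (hne hb) (hdb hb), if_neg]
    rintro ⟨h1, h2⟩
    exact hs ⟨hdim hb h1, fun e =>
      h2 (eq_bot_mono (inf_le_inf_right h (sup_le_sup_left hb.1 _)) e)⟩

lemma Lpmat_mul_commLR_sub (h : Submodule F H) :
    Lpmat h * commLR h - (Fintype.card F : ℂ) • (commLR h * Lpmat h)
      = (-(((Fintype.card F : ℂ) + 1) * (Fintype.card F : ℂ) ^ finrank F H)) •
        (Lpmat h * Astar h (Fintype.card F)) := by
  ext y z
  simp only [Matrix.sub_apply, Matrix.smul_apply, smul_eq_mul, Astar, Matrix.mul_diagonal]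
  by_cases hd : vdim h z = vdim h y + 1
  · by_cases hle : y.1 ≤ z.1
    · have hyz : AttCovers h y z := ⟨hle, hd⟩
      rw [Lpmat_mul_commLR_apply_of_attCovers hyz, commLR_mul_Lpmat_apply_of_attCovers hyz, Lpmat,
        if_pos hyz]
      linear_combination commLR_apply_self_sub hyz
    · rw [Lpmat_mul_commLR_apply_of_not_le hd hle, commLR_mul_Lpmat_apply_of_not_le hd hle, Lpmat,
        if_neg fun hyz : AttCovers h y z => hle hyz.1]
      split_ifs <;> ring
  · rw [Lpmat_mul_apply, mul_Lpmat_apply, Lpmat, if_neg fun hyz : AttCovers h y z => hd hyz.2,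
      Finset.sum_eq_zero, Finset.sum_eq_zero]
    · ring
    · intro b hb
      simp only [Finset.mem_filter, Finset.mem_univ, true_and] at hb
      refine commLR_apply_of_vdim_ne fun e => hd ?_
      rw [hb.2, e]
    · intro a ha
      simp only [Finset.mem_filter, Finset.mem_univ, true_and] at ha
      refine commLR_apply_of_vdim_ne fun e => hd ?_
      rw [← ha.2, e]

omit [Fintype F] [FiniteDimensional F H] in
lemma Rmat_transpose (h : Submodule F H) : (Rmat h)ᵀ = Lpmat h := rfl

omit [Fintype F] [FiniteDimensional F H] in
lemma Lpmat_transpose (h : Submodule F H) : (Lpmat h)ᵀ = Rmat h := rfl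

/-- the relations satisfied by `R`, `L'`, `A*`. -/
theorem stmt3 (q N M : ℕ) (hq : Fintype.card F = q) (hN : 0 < N) (hM : 0 < M)
    (h : Submodule F H) (hH : finrank F H = N + M) (hh : finrank F h = M) :
    Rmat h * Astar h q = (q : ℂ) • (Astar h q * Rmat h) ∧
    Lpmat h * Astar h q = (q : ℂ)⁻¹ • (Astar h q * Lpmat h) ∧
    Lpmat h ^ 2 * Rmat h - ((q : ℂ) + 1) • (Lpmat h * Rmat h * Lpmat h)
        + (q : ℂ) • (Rmat h * Lpmat h ^ 2)
      = (-(((q : ℂ) + 1) * (q : ℂ) ^ (N + M))) • (Lpmat h * Astar h q) ∧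
    Lpmat h * Rmat h ^ 2 - ((q : ℂ) + 1) • (Rmat h * Lpmat h * Rmat h)
        + (q : ℂ) • (Rmat h ^ 2 * Lpmat h)
      = (-(((q : ℂ) + 1) * (q : ℂ) ^ (N + M))) • (Astar h q * Rmat h) := by
  subst hq
  rw [← hH]
  obtain ⟨hq0, -⟩ := one_lt_card_cast (F := F)
  have hcubic : Lpmat h ^ 2 * Rmat h
        - ((Fintype.card F : ℂ) + 1) • (Lpmat h * Rmat h * Lpmat h)
        + (Fintype.card F : ℂ) • (Rmat h * Lpmat h ^ 2)
      = (-(((Fintype.card F : ℂ) + 1) * (Fintype.card F : ℂ) ^ finrank F H)) •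
        (Lpmat h * Astar h (Fintype.card F)) := by
    rw [← Lpmat_mul_commLR_sub, commLR, Matrix.mul_sub, Matrix.sub_mul, add_smul, one_smul,
      smul_sub, sq, Matrix.mul_assoc, Matrix.mul_assoc, Matrix.mul_assoc]
    abel
  refine ⟨?_, ?_, hcubic, ?_⟩
  · ext y z
    simp only [Astar, Matrix.mul_diagonal, Matrix.diagonal_mul, Matrix.smul_apply, smul_eq_mul,
      Rmat]
    split_ifs with hc
    · rw [hc.2, _root_.zpow_neg, _root_.zpow_neg, zpow_natCast, zpow_natCast]
      field_simp
      ring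
    · simp
  · ext y z
    simp only [Astar, Matrix.mul_diagonal, Matrix.diagonal_mul, Matrix.smul_apply, smul_eq_mul,
      Lpmat]
    split_ifs with hc
    · rw [hc.2, _root_.zpow_neg, _root_.zpow_neg, zpow_natCast, zpow_natCast]
      field_simp
      ring
    · simp
  · have ht := congrArg Matrix.transpose hcubic
    simpa only [Matrix.transpose_add, Matrix.transpose_sub, Matrix.transpose_smul,
      Matrix.transpose_mul, Matrix.transpose_pow, Rmat_transpose, Lpmat_transpose, Astar,
      Matrix.diagonal_transpose, Matrix.mul_assoc] using ht
end
end

section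
/- The matrices R, L, A* satisfy: R A* = q A* R; L A* = q^{−1} A* L; L² R − q(q+1) L R L + q³ R L² = −q^{N+M}(q+1) L; and L R² − q(q+1) R L R + q³ R² L = −q^{N+M}(q+1) R. -/
open Module Matrix Finset

noncomputable section

open scoped Classical

variable {F H : Type} [Field F] [Fintype F] [AddCommGroup H] [Module F H]
  [FiniteDimensional F H]

set_option linter.unusedSectionVars false

section Subspaces

theorem finrank_sup_of_inf_eq_bot {y h : Submodule F H} (hy : y ⊓ h = ⊥) :
    finrank F ↑(y ⊔ h) = finrank F y + finrank F h := by
  have := Submodule.finrank_sup_add_finrank_inf_eq y h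
  rwa [hy, finrank_bot, add_zero] at this

theorem sup_eq_of_covers_of_not_le {a u w : Submodule F H} (haw : a ≤ w) (huw : u ≤ w)
    (hd : finrank F w = finrank F a + 1) (hu : ¬ u ≤ a) : a ⊔ u = w := by
  refine Submodule.eq_of_le_of_finrank_le (sup_le haw huw) ?_
  have : finrank F a < finrank F ↑(a ⊔ u) :=
    Submodule.finrank_lt_finrank_of_lt (left_lt_sup.2 hu)
  omega

theorem card_mem_sdiff (a b : Submodule F H) (hab : a ≤ b) [Fintype H] :
    #{v : H | v ∈ b ∧ v ∉ a} + Fintype.card F ^ finrank F a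
      = Fintype.card F ^ finrank F b := by
  have key (c : Submodule F H) : #{v : H | v ∈ c} = Fintype.card F ^ finrank F c := by
    rw [← Module.card_eq_pow_finrank (K := F) (V := c), Fintype.card_subtype]
  rw [← key a, ← key b, ← card_union_of_disjoint]
  · congr 1
    ext v
    simp only [mem_union, mem_filter, mem_univ, true_and]
    constructor
    · rintro (hv | hv)
      exacts [hv.1, hab hv]
    · tauto
  · rw [Finset.disjoint_filter]
    tauto

/-- The number of vertices `w` covering `a` with `w ≤ b` and `¬ w ≤ k`, where `a ≤ k ≤ b`, is
`(q ^ dim b - q ^ dim k) / (q ^ (dim a + 1) - q ^ dim a)`, provided that every such subspace `w`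
is a vertex. -/
theorem card_covers_mul_s4 {h a k b : Submodule F H} (hak : a ≤ k) (hkb : k ≤ b)
    (p : AttX h → Prop) [DecidablePred p]
    (hp : ∀ w, p w ↔ a ≤ w.1 ∧ w.1 ≤ b ∧ ¬ w.1 ≤ k ∧ vdim h w = finrank F a + 1)
    (hX : ∀ v ∈ b, v ∉ k → (a ⊔ F ∙ v) ⊓ h = ⊥) :
    #{w | p w} * Fintype.card F ^ (finrank F a + 1) + Fintype.card F ^ finrank F k
      = Fintype.card F ^ finrank F b + #{w | p w} * Fintype.card F ^ finrank F a := by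
  have : Finite H := Module.finite_of_finite F
  have : Fintype H := Fintype.ofFinite H
  have hcount : #{v : H | v ∈ b ∧ v ∉ k}
      = ∑ w ∈ (univ.filter p).image (fun w : AttX h => w.1), #{v : H | v ∈ w ∧ v ∉ a} := by
    rw [card_eq_sum_card_fiberwise (f := fun v => a ⊔ F ∙ v)
      (t := (univ.filter p).image (fun w : AttX h => w.1))]
    · refine sum_congr rfl fun w hw => ?_
      obtain ⟨w, hpw, rfl⟩ := mem_image.1 hw
      obtain ⟨haw, hwb, hwk, hd⟩ := (hp w).1 (mem_filter.1 hpw).2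
      congr 1
      ext v
      simp only [mem_filter, mem_univ, true_and]
      constructor
      · rintro ⟨⟨-, hvk⟩, hv⟩
        refine ⟨?_, fun hva => hvk (hak hva)⟩
        rw [← hv]
        exact (le_sup_right : F ∙ v ≤ _) (Submodule.mem_span_singleton_self v)
      · rintro ⟨hvw, hva⟩
        have hs : a ⊔ F ∙ v = w.1 :=
          sup_eq_of_covers_of_not_le haw ((Submodule.span_singleton_le_iff_mem _ _).2 hvw) hd
            (by rwa [Submodule.span_singleton_le_iff_mem])
        refine ⟨⟨hwb hvw, fun hvk => hwk ?_⟩, hs⟩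
        rw [← hs]
        exact sup_le hak ((Submodule.span_singleton_le_iff_mem _ _).2 hvk)
    · intro v hv
      obtain ⟨hvb, hvk⟩ := (mem_filter.1 hv).2
      have hva : v ∉ a := fun hva => hvk (hak hva)
      let w : AttX h := ⟨a ⊔ F ∙ v, hX v hvb hvk⟩
      refine mem_coe.2 (mem_image.2 ⟨w, mem_filter.2 ⟨mem_univ _, ?_⟩, rfl⟩)
      refine (hp _).2 ⟨le_sup_left, sup_le (hak.trans hkb)
        ((Submodule.span_singleton_le_iff_mem _ _).2 hvb), fun hle => hvk (hle
          ((le_sup_right : F ∙ v ≤ _) (Submodule.mem_span_singleton_self v))), ?_⟩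
      have hinf : a ⊓ F ∙ v = ⊥ := by
        rw [← disjoint_iff, Submodule.disjoint_span_singleton]
        exact fun hv' => absurd hv' hva
      have hv0 : v ≠ 0 := fun h0 => hva (h0 ▸ a.zero_mem)
      change finrank F ↑(a ⊔ F ∙ v) = _
      rw [finrank_sup_of_inf_eq_bot hinf, finrank_span_singleton hv0]
  have hconst : ∀ w ∈ (univ.filter p).image (fun w : AttX h => w.1),
      #{v : H | v ∈ w ∧ v ∉ a}
        = Fintype.card F ^ (finrank F a + 1) - Fintype.card F ^ finrank F a := by
    intro w hw
    obtain ⟨w, hpw, rfl⟩ := mem_image.1 hw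
    obtain ⟨haw, -, -, hd⟩ := (hp w).1 (mem_filter.1 hpw).2
    have := card_mem_sdiff a w.1 haw
    rw [show finrank F w.1 = finrank F a + 1 from hd] at this
    omega
  have hinj : #((univ.filter p).image (fun w : AttX h => w.1)) = #{w | p w} :=
    card_image_of_injective _ fun _ _ => Subtype.ext
  rw [sum_congr rfl hconst, sum_const, hinj, smul_eq_mul] at hcount
  have h1 := card_mem_sdiff k b hkb
  have h2 : Fintype.card F ^ finrank F a ≤ Fintype.card F ^ (finrank F a + 1) :=
    Nat.pow_le_pow_right Fintype.card_pos (Nat.le_succ _)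
  have h3 : #{w | p w} * Fintype.card F ^ (finrank F a + 1)
      = #{w | p w} * (Fintype.card F ^ (finrank F a + 1) - Fintype.card F ^ finrank F a)
        + #{w | p w} * Fintype.card F ^ finrank F a := by
    rw [← mul_add, Nat.sub_add_cancel h2]
  rw [h3, ← h1, hcount]
  ring

theorem eq_of_mul_pow_add_pow {q n d e : ℕ} (hq : 1 < q) (he : e < 2)
    (hn : n * q ^ (d + 1) + q ^ (d + e) = q ^ (d + 2) + n * q ^ d) : n + e = q + 1 := by
  have hpos : 0 < q ^ d := by positivity
  have h1 : n * q + q ^ e = q ^ 2 + n := by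
    apply Nat.eq_of_mul_eq_mul_left hpos
    calc q ^ d * (n * q + q ^ e) = n * q ^ (d + 1) + q ^ (d + e) := by ring
      _ = _ := hn
      _ = _ := by ring
  zify at *
  have h2 : ((n : ℤ) + e - (q + 1)) * (q - 1) = 0 := by
    obtain rfl | rfl : e = 0 ∨ e = 1 := by omega
    all_goals push_cast at *; linarith
  rcases mul_eq_zero.1 h2 with h2 | h2 <;> linarith

theorem inf_eq_bot_iff_of_covers {y w h : Submodule F H} (hy : y ⊓ h = ⊥) (hyw : y ≤ w)
    (hd : finrank F w = finrank F y + 1) : w ⊓ h = ⊥ ↔ ¬ w ≤ y ⊔ h := by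
  have h1 := finrank_sup_of_inf_eq_bot hy
  constructor
  · intro hw hle
    have h2 := finrank_sup_of_inf_eq_bot hw
    have h3 := Submodule.finrank_mono (sup_le hle (le_sup_right : h ≤ y ⊔ h))
    omega
  · intro hle
    have h2 := Submodule.finrank_sup_add_finrank_inf_eq w h
    have h3 : finrank F ↑(y ⊔ h) < finrank F ↑(w ⊔ h) :=
      Submodule.finrank_lt_finrank_of_lt
        (lt_of_le_not_ge (sup_le_sup_right hyw h) fun hle' => hle (le_sup_left.trans hle'))
    rw [← Submodule.finrank_eq_zero (R := F)]
    omega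

end Subspaces

section Counts

variable {h : Submodule F H}

theorem inf_eq_bot_of_le (y : AttX h) {w : Submodule F H} (hw : w ≤ y.1) : w ⊓ h = ⊥ :=
  le_bot_iff.1 ((inf_le_inf_right h hw).trans y.2.le)

/-- The vertex `w` contained in the vertex `y`. -/
def AttX.ofLe (y : AttX h) (w : Submodule F H) (hw : w ≤ y.1) : AttX h :=
  ⟨w, inf_eq_bot_of_le y hw⟩

theorem card_covering (y : AttX h) :
    #{w | AttCovers h y w} * Fintype.card F ^ (vdim h y + 1)
        + Fintype.card F ^ (vdim h y + finrank F h)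
      = Fintype.card F ^ finrank F H + #{w | AttCovers h y w} * Fintype.card F ^ vdim h y := by
  have key := card_covers_mul_s4 (h := h) (a := y.1) (k := y.1 ⊔ h) (b := ⊤) le_sup_left le_top
    (AttCovers h y) ?_ ?_
  · rwa [finrank_sup_of_inf_eq_bot y.2, finrank_top] at key
  · intro w
    constructor
    · rintro ⟨hle, hd⟩
      exact ⟨hle, le_top, (inf_eq_bot_iff_of_covers y.2 hle hd).1 w.2, hd⟩
    · rintro ⟨hle, -, -, hd⟩
      exact ⟨hle, hd⟩
  · intro v _ hv
    have hvy : v ∉ y.1 := fun hvy => hv ((le_sup_left : y.1 ≤ _) hvy)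
    have hinf : y.1 ⊓ F ∙ v = ⊥ := by
      rw [← disjoint_iff, Submodule.disjoint_span_singleton]
      exact fun hv' => absurd hv' hvy
    have hv0 : v ≠ 0 := fun h0 => hvy (h0 ▸ y.1.zero_mem)
    refine (inf_eq_bot_iff_of_covers y.2 le_sup_left ?_).2 fun hle => hv (hle
      ((le_sup_right : F ∙ v ≤ _) (Submodule.mem_span_singleton_self v)))
    rw [finrank_sup_of_inf_eq_bot hinf, finrank_span_singleton hv0]

/-- In an interval of rank two with lower end `a` and upper end `z`, the number of middle elements
not below `k`. -/
theorem card_middle {a k : Submodule F H} {z : AttX h} {e : ℕ} (he : e < 2) (hak : a ≤ k)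
    (hkz : k ≤ z.1) (hk : finrank F k = finrank F a + e) (hz : vdim h z = finrank F a + 2)
    (p : AttX h → Prop) [DecidablePred p]
    (hp : ∀ w, p w ↔ a ≤ w.1 ∧ w.1 ≤ z.1 ∧ ¬ w.1 ≤ k ∧ vdim h w = finrank F a + 1) :
    #{w | p w} + e = Fintype.card F + 1 := by
  have key := card_covers_mul_s4 hak hkz p hp fun v hv _ => inf_eq_bot_of_le z
    (sup_le (hak.trans hkz) ((Submodule.span_singleton_le_iff_mem _ _).2 hv))
  rw [hk, show finrank F z.1 = finrank F a + 2 from hz] at key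
  exact eq_of_mul_pow_add_pow Fintype.one_lt_card he key

theorem card_between {y z : AttX h} (hyz : y.1 ≤ z.1) (hd : vdim h z = vdim h y + 2) :
    #{w | AttCovers h y w ∧ AttCovers h w z} = Fintype.card F + 1 := by
  refine card_middle (e := 0) (by norm_num) le_rfl hyz rfl hd
    (fun w => AttCovers h y w ∧ AttCovers h w z) fun w => ?_
  simp only [AttCovers, vdim] at *
  constructor
  · rintro ⟨⟨h1, h2⟩, h3, h4⟩
    refine ⟨h1, h3, fun hle => ?_, h2⟩
    have := Submodule.finrank_mono hle
    omega
  · rintro ⟨h1, h3, -, h2⟩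
    exact ⟨⟨h1, h2⟩, h3, by omega⟩

theorem AttCovers.inf {y w z : AttX h} (hy : AttCovers h y z) (hw : AttCovers h w z)
    (hne : w ≠ y) : finrank F ↑(y.1 ⊓ w.1) + 1 = vdim h y := by
  have hd : finrank F w.1 = finrank F y.1 := by
    have := hy.2; have := hw.2; simp only [vdim] at *; omega
  have hnle : ¬ w.1 ≤ y.1 := fun hle =>
    hne (Subtype.ext (Submodule.eq_of_le_of_finrank_eq hle hd))
  have h1 := sup_eq_of_covers_of_not_le hy.1 hw.1 hy.2 hnle
  have h2 := Submodule.finrank_sup_add_finrank_inf_eq y.1 w.1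
  have h3 := hy.2
  simp only [vdim] at *
  rw [h1] at h2
  omega

theorem card_covered_ne {y z : AttX h} (hyz : AttCovers h y z) :
    #{w | AttCovers h w z ∧ w ≠ y} = Fintype.card F * #{w | AttCovers h w y} := by
  rw [card_eq_sum_card_fiberwise (f := fun w : AttX h => y.ofLe (y.1 ⊓ w.1) inf_le_left)
    (t := {w | AttCovers h w y}), sum_const_nat, mul_comm]
  · intro x hx
    have hxy : AttCovers h x y := by simpa using hx
    rw [filter_filter]
    refine Nat.succ_injective (card_middle (a := x.1) (k := y.1) (z := z) (e := 1) (by norm_num)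
      hxy.1 hyz.1 hxy.2 (by rw [hyz.2, hxy.2]; rfl) _ fun w => ?_)
    constructor
    · rintro ⟨⟨hwz, hne⟩, hx⟩
      have hx' : y.1 ⊓ w.1 = x.1 := congrArg Subtype.val hx
      have h1 := hwz.2; have h2 := hyz.2; have h3 := hxy.2
      have hd : finrank F w.1 = finrank F y.1 := by simp only [vdim] at *; omega
      refine ⟨hx' ▸ inf_le_right, hwz.1, fun hle =>
        hne (Subtype.ext (Submodule.eq_of_le_of_finrank_eq hle hd)), ?_⟩
      simp only [vdim] at *; omega
    · rintro ⟨hxw, hwz, hnle, hd⟩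
      have h2 := hyz.2; have h3 := hxy.2
      have hw : AttCovers h w z := ⟨hwz, by simp only [vdim] at *; omega⟩
      have hne : w ≠ y := fun he => hnle (he ▸ le_rfl)
      refine ⟨⟨hw, hne⟩, Subtype.ext (Submodule.eq_of_le_of_finrank_eq
        (le_inf hxy.1 hxw) ?_).symm⟩
      have := hyz.inf hw hne
      simp only [vdim] at *; omega
  · intro w hw
    have hw' : AttCovers h w z ∧ w ≠ y := by simpa using hw
    have : AttCovers h (y.ofLe (y.1 ⊓ w.1) inf_le_left) y :=
      ⟨inf_le_left, (hyz.inf hw'.1 hw'.2).symm⟩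
    simpa using this

end Counts

section Products

variable {h : Submodule F H}

theorem card_common_cover {y w : AttX h} (hne : w ≠ y) :
    #{x | AttCovers h y x ∧ AttCovers h w x}
      = if vdim h w = vdim h y ∧ finrank F ↑(y.1 ⊔ w.1) = vdim h y + 1 ∧ (y.1 ⊔ w.1) ⊓ h = ⊥
        then 1 else 0 := by
  have hsup (x : AttX h) (hy : AttCovers h y x) (hw : AttCovers h w x) : y.1 ⊔ w.1 = x.1 := by
    have hd : finrank F w.1 = finrank F y.1 := by
      have := hy.2; have := hw.2; simp only [vdim] at *; omega
    exact sup_eq_of_covers_of_not_le hy.1 hw.1 hy.2 fun hle =>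
      hne (Subtype.ext (Submodule.eq_of_le_of_finrank_eq hle hd))
  split_ifs with hc
  · obtain ⟨hd, hs, hX⟩ := hc
    let s : AttX h := ⟨y.1 ⊔ w.1, hX⟩
    rw [card_eq_one]
    refine ⟨s, ?_⟩
    ext x
    simp only [mem_filter, mem_univ, true_and, mem_singleton]
    constructor
    · rintro ⟨hy, hw⟩
      exact Subtype.ext (hsup x hy hw).symm
    · rintro rfl
      exact ⟨⟨le_sup_left, hs⟩, le_sup_right, by rw [hd]; exact hs⟩
  · rw [card_eq_zero, filter_eq_empty_iff]
    rintro x - ⟨hy, hw⟩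
    have hx := hsup x hy hw
    refine hc ⟨?_, ?_, by rw [hx]; exact x.2⟩
    · have := hy.2; have := hw.2; omega
    · rw [hx]; exact hy.2

theorem lpmat_mul_lpmat_apply (y z : AttX h) :
    (Lpmat h * Lpmat h) y z
      = if y.1 ≤ z.1 ∧ vdim h z = vdim h y + 2 then (Fintype.card F : ℂ) + 1 else 0 := by
  simp only [Matrix.mul_apply, Lpmat, ite_zero_mul_ite_zero, mul_one, sum_boole]
  split_ifs with hc
  · rw [card_between hc.1 hc.2]
    push_cast
    rfl
  · rw [Nat.cast_eq_zero, card_eq_zero, filter_eq_empty_iff]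
    rintro x - ⟨hy, hz⟩
    have := hy.2; have := hz.2
    exact hc ⟨hy.1.trans hz.1, by omega⟩

theorem lpmat_mul_lpmat_mul_rmat_apply (y z : AttX h) :
    (Lpmat h * Lpmat h * Rmat h) y z = ((Fintype.card F : ℂ) + 1)
      * #{w | (y.1 ≤ w.1 ∧ vdim h w = vdim h y + 2) ∧ AttCovers h z w} := by
  rw [Matrix.mul_apply]
  simp only [lpmat_mul_lpmat_apply, Rmat, ite_zero_mul_ite_zero, mul_one]
  rw [← sum_filter, sum_const, nsmul_eq_mul, mul_comm]

theorem rmat_mul_lpmat_mul_lpmat_apply (y z : AttX h) :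
    (Rmat h * (Lpmat h * Lpmat h)) y z = ((Fintype.card F : ℂ) + 1)
      * #{w | AttCovers h w y ∧ (w.1 ≤ z.1 ∧ vdim h z = vdim h w + 2)} := by
  rw [Matrix.mul_apply]
  simp only [lpmat_mul_lpmat_apply, Rmat, ite_zero_mul_ite_zero, one_mul]
  rw [← sum_filter, sum_const, nsmul_eq_mul, mul_comm]

theorem lpmat_mul_rmat_mul_lpmat_apply (y z : AttX h) :
    (Lpmat h * Rmat h * Lpmat h) y z
      = ∑ w with AttCovers h w z, (#{x | AttCovers h y x ∧ AttCovers h w x} : ℂ) := by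
  rw [Matrix.mul_apply, sum_filter]
  refine sum_congr rfl fun w _ => ?_
  simp only [Matrix.mul_apply, Lpmat, Rmat, ite_zero_mul_ite_zero, mul_one, sum_boole]
  split_ifs <;> simp

/-- The relation at a pair `y`, `z` where `z` covers `y`. -/
theorem lowering_relation_apply_of_covers {y z : AttX h} (hyz : AttCovers h y z) :
    (Lpmat h * Lpmat h * Rmat h) y z
        - ((Fintype.card F : ℂ) + 1) * (Lpmat h * Rmat h * Lpmat h) y z
        + (Fintype.card F : ℂ) * (Rmat h * (Lpmat h * Lpmat h)) y z
      = ((Fintype.card F : ℂ) + 1) * (#{w | AttCovers h z w} - #{w | AttCovers h y w}) := by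
  have h1 : #{w | (y.1 ≤ w.1 ∧ vdim h w = vdim h y + 2) ∧ AttCovers h z w}
      = #{w | AttCovers h z w} := by
    congr 1
    refine filter_congr fun w _ => and_iff_right_of_imp fun hw => ⟨hyz.1.trans hw.1, ?_⟩
    rw [hw.2, hyz.2]
  have h3 : #{w | AttCovers h w y ∧ (w.1 ≤ z.1 ∧ vdim h z = vdim h w + 2)}
      = #{w | AttCovers h w y} := by
    congr 1
    refine filter_congr fun w _ => and_iff_left_of_imp fun hw => ⟨hw.1.trans hyz.1, ?_⟩
    rw [hyz.2, hw.2]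
  have h2 : ∑ w with AttCovers h w z, (#{x | AttCovers h y x ∧ AttCovers h w x} : ℂ)
      = #{w | AttCovers h y w} + (Fintype.card F : ℂ) * #{w | AttCovers h w y} := by
    rw [← add_sum_erase _ _ (mem_filter.2 ⟨mem_univ y, hyz⟩), ← Nat.cast_mul,
      ← card_covered_ne hyz]
    simp only [and_self]
    congr 1
    rw [sum_congr rfl (g := fun _ => 1), sum_const, nsmul_one]
    · congr 2
      ext w
      simp only [mem_erase, mem_filter, mem_univ, true_and]
      tauto
    · intro w hw
      obtain ⟨hne, hw⟩ := mem_erase.1 hw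
      replace hw := (mem_filter.1 hw).2
      have hnle : ¬ w.1 ≤ y.1 := fun hle =>
        hne (Subtype.ext (Submodule.eq_of_le_of_finrank_eq hle
          (Nat.succ_injective (hw.2.symm.trans hyz.2))))
      have hs := sup_eq_of_covers_of_not_le hyz.1 hw.1 hyz.2 hnle
      rw [card_common_cover hne, if_pos, Nat.cast_one]
      rw [hs]
      exact ⟨Nat.succ_injective (hw.2.symm.trans hyz.2), hyz.2, z.2⟩
  rw [lpmat_mul_lpmat_mul_rmat_apply, lpmat_mul_rmat_mul_lpmat_apply,
    rmat_mul_lpmat_mul_lpmat_apply, h1, h2, h3]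
  ring

/-- All three products vanish at `y`, `z` unless `dim z = dim y + 1`. -/
theorem products_apply_eq_zero_of_vdim_ne {y z : AttX h} (hd : vdim h z ≠ vdim h y + 1) :
    (Lpmat h * Lpmat h * Rmat h) y z = 0 ∧ (Lpmat h * Rmat h * Lpmat h) y z = 0 ∧
      (Rmat h * (Lpmat h * Lpmat h)) y z = 0 := by
  rw [lpmat_mul_lpmat_mul_rmat_apply, lpmat_mul_rmat_mul_lpmat_apply,
    rmat_mul_lpmat_mul_lpmat_apply]
  refine ⟨?_, sum_eq_zero fun w hw => ?_, ?_⟩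
  · rw [filter_false_of_mem, card_empty, Nat.cast_zero, mul_zero]
    rintro w - ⟨⟨-, h1⟩, -, h2⟩
    omega
  · rw [Nat.cast_eq_zero, card_eq_zero, filter_eq_empty_iff]
    rintro x - ⟨⟨-, h1⟩, -, h2⟩
    have := (mem_filter.1 hw).2.2
    omega
  · rw [filter_false_of_mem, card_empty, Nat.cast_zero, mul_zero]
    rintro w - ⟨⟨-, h1⟩, -, h2⟩
    omega

theorem card_upper_of_not_le {y z : AttX h} (hd : vdim h z = vdim h y + 1) (hle : ¬ y.1 ≤ z.1) :
    #{w | (y.1 ≤ w.1 ∧ vdim h w = vdim h y + 2) ∧ AttCovers h z w}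
      = if finrank F ↑(y.1 ⊓ z.1) + 1 = vdim h y ∧ (y.1 ⊔ z.1) ⊓ h = ⊥ then 1 else 0 := by
  have hf := Submodule.finrank_sup_add_finrank_inf_eq y.1 z.1
  have hsup (w : AttX h) (hy : y.1 ≤ w.1) (hw : AttCovers h z w) : y.1 ⊔ z.1 = w.1 := by
    rw [sup_comm]
    exact sup_eq_of_covers_of_not_le hw.1 hy hw.2 hle
  split_ifs with hc
  · obtain ⟨hi, hX⟩ := hc
    let s : AttX h := ⟨y.1 ⊔ z.1, hX⟩
    rw [card_eq_one]
    refine ⟨s, ?_⟩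
    ext w
    simp only [mem_filter, mem_univ, true_and, mem_singleton]
    constructor
    · rintro ⟨⟨hy, -⟩, hw⟩
      exact Subtype.ext (hsup w hy hw).symm
    · rintro rfl
      have : vdim h s = vdim h y + 2 := by simp only [vdim, s] at *; omega
      exact ⟨⟨le_sup_left, this⟩, le_sup_right, by omega⟩
  · rw [card_eq_zero, filter_eq_empty_iff]
    rintro w - ⟨⟨hy, hw2⟩, hw⟩
    have hx := hsup w hy hw
    refine hc ⟨?_, by rw [hx]; exact w.2⟩
    rw [hx] at hf
    simp only [vdim] at *; omega

theorem card_lower_of_not_le {y z : AttX h} (hd : vdim h z = vdim h y + 1) (hle : ¬ y.1 ≤ z.1) :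
    #{w | AttCovers h w y ∧ (w.1 ≤ z.1 ∧ vdim h z = vdim h w + 2)}
      = if finrank F ↑(y.1 ⊓ z.1) + 1 = vdim h y then 1 else 0 := by
  have hlt : finrank F ↑(y.1 ⊓ z.1) < finrank F y.1 :=
    Submodule.finrank_lt_finrank_of_lt (inf_lt_left.2 hle)
  split_ifs with hc
  · rw [card_eq_one]
    refine ⟨y.ofLe (y.1 ⊓ z.1) inf_le_left, ?_⟩
    ext w
    simp only [mem_filter, mem_univ, true_and, mem_singleton]
    constructor
    · rintro ⟨hw, hz, -⟩
      refine Subtype.ext (Submodule.eq_of_le_of_finrank_eq (le_inf hw.1 hz) ?_)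
      exact Nat.succ_injective (hw.2.symm.trans hc.symm)
    · rintro rfl
      refine ⟨⟨inf_le_left, hc.symm⟩, inf_le_right, ?_⟩
      rw [hd, ← hc]
      rfl
  · rw [card_eq_zero, filter_eq_empty_iff]
    rintro w - ⟨hw, hz, -⟩
    have h1 := Submodule.finrank_mono (le_inf hw.1 hz)
    have h2 := hw.2
    simp only [vdim] at *; omega

theorem finrank_inf_sup_of_covers {y z : AttX h} (hd : vdim h z = vdim h y + 1)
    (hi : finrank F ↑(y.1 ⊓ z.1) + 1 = vdim h y) :
    finrank F ↑(z.1 ⊓ (y.1 ⊔ h))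
      = finrank F ↑(y.1 ⊓ z.1) + if (y.1 ⊔ z.1) ⊓ h = ⊥ then 0 else 1 := by
  have h1 := Submodule.finrank_sup_add_finrank_inf_eq z.1 (y.1 ⊔ h)
  have h2 := Submodule.finrank_sup_add_finrank_inf_eq (y.1 ⊔ z.1) h
  have h3 := Submodule.finrank_sup_add_finrank_inf_eq y.1 z.1
  have h4 := finrank_sup_of_inf_eq_bot y.2
  rw [show z.1 ⊔ (y.1 ⊔ h) = y.1 ⊔ z.1 ⊔ h by ac_rfl] at h1
  simp only [vdim] at *
  split_ifs with hX
  · rw [hX, finrank_bot] at h2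
    omega
  · have h5 : finrank F ↑((y.1 ⊔ z.1) ⊓ h) ≠ 0 := by rwa [Ne, Submodule.finrank_eq_zero]
    have h6 : z.1 ⊓ ((y.1 ⊔ z.1) ⊓ h) = ⊥ :=
      le_bot_iff.1 ((inf_le_inf_left _ inf_le_right).trans z.2.le)
    have h7 := finrank_sup_of_inf_eq_bot h6
    have h8 : finrank F ↑(z.1 ⊔ (y.1 ⊔ z.1) ⊓ h) ≤ finrank F ↑(y.1 ⊔ z.1) :=
      Submodule.finrank_mono (sup_le le_sup_right inf_le_left)
    omega

theorem sum_common_cover_of_not_le {y z : AttX h} (hd : vdim h z = vdim h y + 1)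
    (hle : ¬ y.1 ≤ z.1) :
    (∑ w with AttCovers h w z, #{x | AttCovers h y x ∧ AttCovers h w x})
        + (if finrank F ↑(y.1 ⊓ z.1) + 1 = vdim h y ∧ ¬ (y.1 ⊔ z.1) ⊓ h = ⊥ then 1 else 0)
      = if finrank F ↑(y.1 ⊓ z.1) + 1 = vdim h y then Fintype.card F + 1 else 0 := by
  have hlt : finrank F ↑(y.1 ⊓ z.1) < finrank F y.1 :=
    Submodule.finrank_lt_finrank_of_lt (inf_lt_left.2 hle)
  have hsum : ∑ w with AttCovers h w z, #{x | AttCovers h y x ∧ AttCovers h w x}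
      = #{w | AttCovers h w z ∧ vdim h w = vdim h y ∧
          finrank F ↑(y.1 ⊔ w.1) = vdim h y + 1 ∧ (y.1 ⊔ w.1) ⊓ h = ⊥} := by
    rw [← filter_filter, card_filter]
    exact sum_congr rfl fun w hw =>
      card_common_cover fun he => hle (he ▸ (mem_filter.1 hw).2.1)
  have hinf (w : AttX h) (hw : AttCovers h w z) : y.1 ⊓ w.1 ≤ y.1 ⊓ z.1 :=
    inf_le_inf_left _ hw.1
  rw [hsum]
  by_cases hc : finrank F ↑(y.1 ⊓ z.1) + 1 = vdim h y
  · have hk := finrank_inf_sup_of_covers hd hc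
    simp only [hc, true_and, if_true]
    rw [ite_not]
    refine card_middle (by split_ifs <;> norm_num) (le_inf inf_le_right
      (inf_le_left.trans le_sup_left)) inf_le_left hk (by omega) _ fun w => ?_
    have hf := Submodule.finrank_sup_add_finrank_inf_eq y.1 w.1
    constructor
    · rintro ⟨hw, hwd, hs, hX⟩
      have hE : y.1 ⊓ w.1 = y.1 ⊓ z.1 := by
        refine Submodule.eq_of_le_of_finrank_eq (hinf w hw) ?_
        simp only [vdim] at *; omega
      refine ⟨hE ▸ inf_le_right, hw.1, fun hwk => ?_, by omega⟩
      exact (inf_eq_bot_iff_of_covers y.2 le_sup_left hs).1 hX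
        (sup_le le_sup_left (hwk.trans inf_le_right))
    · rintro ⟨haw, hwz, hwk, hwd⟩
      have hw : AttCovers h w z := ⟨hwz, by omega⟩
      have hE : y.1 ⊓ w.1 = y.1 ⊓ z.1 := le_antisymm (hinf w hw) (le_inf inf_le_left haw)
      have hs : finrank F ↑(y.1 ⊔ w.1) = vdim h y + 1 := by
        rw [hE] at hf
        simp only [vdim] at *; omega
      refine ⟨hw, by omega, hs, (inf_eq_bot_iff_of_covers y.2 le_sup_left hs).2 fun hle' => ?_⟩
      exact hwk (le_inf hwz (le_sup_right.trans hle'))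
  · simp only [hc, false_and, if_false, add_zero]
    rw [card_eq_zero, filter_eq_empty_iff]
    rintro w - ⟨hw, hwd, hs, -⟩
    have hf := Submodule.finrank_sup_add_finrank_inf_eq y.1 w.1
    have := Submodule.finrank_mono (hinf w hw)
    simp only [vdim] at *; omega

/-- The relation at a pair `y`, `z` where `z` does not cover `y`. -/
theorem lowering_relation_apply_of_not_covers {y z : AttX h} (hyz : ¬ AttCovers h y z) :
    (Lpmat h * Lpmat h * Rmat h) y z
        - ((Fintype.card F : ℂ) + 1) * (Lpmat h * Rmat h * Lpmat h) y z
        + (Fintype.card F : ℂ) * (Rmat h * (Lpmat h * Lpmat h)) y z = 0 := by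
  by_cases hd : vdim h z = vdim h y + 1
  · have hle : ¬ y.1 ≤ z.1 := fun hle => hyz ⟨hle, hd⟩
    have h2 := congrArg (Nat.cast : ℕ → ℂ) (sum_common_cover_of_not_le hd hle)
    rw [lpmat_mul_lpmat_mul_rmat_apply, lpmat_mul_rmat_mul_lpmat_apply,
      rmat_mul_lpmat_mul_lpmat_apply, card_upper_of_not_le hd hle, card_lower_of_not_le hd hle]
    rw [Nat.cast_add, Nat.cast_sum] at h2
    rw [eq_sub_of_add_eq h2]
    split_ifs <;> first | tauto | (push_cast; ring)
  · obtain ⟨h1, h2, h3⟩ := products_apply_eq_zero_of_vdim_ne hd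
    rw [h1, h2, h3]
    ring

theorem card_covering_sub {y z : AttX h} (hyz : AttCovers h y z) :
    (#{w | AttCovers h z w} : ℂ) - #{w | AttCovers h y w}
      = -((Fintype.card F : ℂ)⁻¹ * (Fintype.card F : ℂ) ^ finrank F H
          * ((Fintype.card F : ℂ) ^ vdim h y)⁻¹) := by
  have hy := congrArg (Nat.cast : ℕ → ℂ) (card_covering y)
  have hz := congrArg (Nat.cast : ℕ → ℂ) (card_covering z)
  rw [hyz.2] at hz
  push_cast at hy hz
  have hq0 : (Fintype.card F : ℂ) ≠ 0 := Nat.cast_ne_zero.2 Fintype.card_ne_zero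
  have hq1 : (Fintype.card F : ℂ) - 1 ≠ 0 :=
    sub_ne_zero.2 (Nat.cast_ne_one.2 Fintype.one_lt_card.ne')
  field_simp
  apply mul_right_cancel₀ hq1
  linear_combination hz - (Fintype.card F : ℂ) * hy

/-- The cubic relation for the unweighted lowering matrix. -/
theorem lowering_relation :
    Lpmat h * Lpmat h * Rmat h - ((Fintype.card F : ℂ) + 1) • (Lpmat h * Rmat h * Lpmat h)
        + (Fintype.card F : ℂ) • (Rmat h * (Lpmat h * Lpmat h))
      = (-((Fintype.card F : ℂ)⁻¹ * (Fintype.card F : ℂ) ^ finrank F H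
          * ((Fintype.card F : ℂ) + 1))) • (Astar h (Fintype.card F) * Lpmat h) := by
  ext y z
  simp only [Matrix.add_apply, Matrix.sub_apply, Matrix.smul_apply, smul_eq_mul, Astar,
    Matrix.diagonal_mul, _root_.zpow_neg, zpow_natCast]
  by_cases hyz : AttCovers h y z
  · rw [lowering_relation_apply_of_covers hyz, card_covering_sub hyz, Lpmat, if_pos hyz]
    ring
  · rw [lowering_relation_apply_of_not_covers hyz, Lpmat, if_neg hyz]
    ring

theorem transpose_lpmat : (Lpmat h)ᵀ = Rmat h := rfl

theorem transpose_rmat : (Rmat h)ᵀ = Lpmat h := rfl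

/-- The transpose of `lowering_relation`. -/
theorem raising_relation :
    Lpmat h * (Rmat h * Rmat h) - ((Fintype.card F : ℂ) + 1) • (Rmat h * (Lpmat h * Rmat h))
        + (Fintype.card F : ℂ) • (Rmat h * Rmat h * Lpmat h)
      = (-((Fintype.card F : ℂ)⁻¹ * (Fintype.card F : ℂ) ^ finrank F H
          * ((Fintype.card F : ℂ) + 1))) • (Rmat h * Astar h (Fintype.card F)) := by
  have key := congrArg Matrix.transpose (lowering_relation (h := h))
  have hA : (Astar h (Fintype.card F))ᵀ = Astar h (Fintype.card F) := diagonal_transpose _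
  simpa only [transpose_add, transpose_sub, transpose_smul, transpose_mul, transpose_lpmat,
    transpose_rmat, hA] using key

theorem rmat_mul_astar {q : ℕ} (hq : q ≠ 0) :
    Rmat h * Astar h q = (q : ℂ) • (Astar h q * Rmat h) := by
  have hq' : (q : ℂ) ≠ 0 := Nat.cast_ne_zero.2 hq
  ext y z
  simp only [Astar, Matrix.mul_diagonal, Matrix.diagonal_mul, Matrix.smul_apply, smul_eq_mul,
    Rmat, _root_.zpow_neg, zpow_natCast]
  split_ifs with hc
  · rw [hc.2, pow_succ]
    field_simp
  · ring

/-- The inverse of the dual adjacency matrix. -/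
def AstarInv (h : Submodule F H) (q : ℕ) : Matrix (AttX h) (AttX h) ℂ :=
  Matrix.diagonal fun y => (q : ℂ) ^ vdim h y

theorem astarInv_mul_astar {q : ℕ} (hq : q ≠ 0) : AstarInv h q * Astar h q = 1 := by
  have hq' : (q : ℂ) ≠ 0 := Nat.cast_ne_zero.2 hq
  simp [AstarInv, Astar, hq']

theorem lmat_eq (q : ℕ) : Lmat h q = AstarInv h q * Lpmat h := by
  ext y z
  simp [AstarInv, Lmat, Lpmat]

theorem lpmat_mul_astarInv (q : ℕ) :
    Lpmat h * AstarInv h q = (q : ℂ) • (AstarInv h q * Lpmat h) := by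
  ext y z
  simp only [AstarInv, Matrix.mul_diagonal, Matrix.diagonal_mul, Matrix.smul_apply, smul_eq_mul,
    Lpmat]
  split_ifs with hc
  · rw [hc.2]
    ring
  · ring

theorem astarInv_mul_rmat (q : ℕ) :
    AstarInv h q * Rmat h = (q : ℂ) • (Rmat h * AstarInv h q) := by
  have key := congrArg Matrix.transpose (lpmat_mul_astarInv (h := h) q)
  have hA : (AstarInv h q)ᵀ = AstarInv h q := diagonal_transpose _
  simpa only [transpose_smul, transpose_mul, transpose_lpmat, hA] using key

theorem rmat_mul_astarInv {q : ℕ} (hq : q ≠ 0) :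
    Rmat h * AstarInv h q = (q : ℂ)⁻¹ • (AstarInv h q * Rmat h) := by
  rw [astarInv_mul_rmat, inv_smul_smul₀ (Nat.cast_ne_zero.2 hq)]

theorem lmat_mul_astar {q : ℕ} (hq : q ≠ 0) :
    Lmat h q * Astar h q = (q : ℂ)⁻¹ • (Astar h q * Lmat h q) := by
  have hq' : (q : ℂ) ≠ 0 := Nat.cast_ne_zero.2 hq
  ext y z
  simp only [Astar, Matrix.mul_diagonal, Matrix.diagonal_mul, Matrix.smul_apply, smul_eq_mul,
    Lmat, _root_.zpow_neg, zpow_natCast]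
  split_ifs with hc
  · rw [hc.2, pow_succ]
    field_simp
  · ring

theorem lmat_sq_mul_rmat (q : ℕ) :
    Lmat h q ^ 2 * Rmat h
      = (q : ℂ) • (AstarInv h q * (AstarInv h q * (Lpmat h * Lpmat h * Rmat h))) := by
  simp only [lmat_eq, pow_two, Matrix.mul_assoc]
  rw [← Matrix.mul_assoc (Lpmat h) (AstarInv h q), lpmat_mul_astarInv]
  simp only [Matrix.mul_assoc, Matrix.smul_mul, Matrix.mul_smul]

theorem lmat_mul_rmat_mul_lmat {q : ℕ} (hq : q ≠ 0) :
    Lmat h q * Rmat h * Lmat h q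
      = AstarInv h q * (AstarInv h q * (Lpmat h * Rmat h * Lpmat h)) := by
  simp only [lmat_eq, Matrix.mul_assoc]
  rw [← Matrix.mul_assoc (Rmat h) (AstarInv h q), rmat_mul_astarInv hq, Matrix.smul_mul,
    Matrix.mul_smul, ← Matrix.mul_assoc (Lpmat h), ← Matrix.mul_assoc (Lpmat h),
    lpmat_mul_astarInv]
  simp only [Matrix.mul_assoc, Matrix.smul_mul, Matrix.mul_smul]
  rw [inv_smul_smul₀ (Nat.cast_ne_zero.2 hq)]

theorem rmat_mul_lmat {q : ℕ} (hq : q ≠ 0) :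
    Rmat h * Lmat h q = (q : ℂ)⁻¹ • (AstarInv h q * (Rmat h * Lpmat h)) := by
  rw [lmat_eq, ← Matrix.mul_assoc, rmat_mul_astarInv hq, Matrix.smul_mul, Matrix.mul_assoc]

theorem rmat_mul_lmat_sq {q : ℕ} (hq : q ≠ 0) :
    Rmat h * Lmat h q ^ 2
      = (q : ℂ)⁻¹ • (AstarInv h q * (AstarInv h q * (Rmat h * (Lpmat h * Lpmat h)))) := by
  have hq' : (q : ℂ) ≠ 0 := Nat.cast_ne_zero.2 hq
  rw [pow_two, ← Matrix.mul_assoc, rmat_mul_lmat hq, lmat_eq]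
  simp only [Matrix.mul_assoc, Matrix.smul_mul]
  rw [← Matrix.mul_assoc (Lpmat h) (AstarInv h q), lpmat_mul_astarInv]
  simp only [Matrix.mul_assoc, Matrix.smul_mul, Matrix.mul_smul]
  rw [← Matrix.mul_assoc (Rmat h) (AstarInv h q), rmat_mul_astarInv hq]
  simp only [Matrix.mul_assoc, Matrix.smul_mul, Matrix.mul_smul]
  rw [smul_inv_smul₀ hq']

theorem rmat_sq_mul_lmat {q : ℕ} (hq : q ≠ 0) :
    Rmat h ^ 2 * Lmat h q
      = ((q : ℂ) ^ 2)⁻¹ • (AstarInv h q * (Rmat h * Rmat h * Lpmat h)) := by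
  rw [pow_two, Matrix.mul_assoc, rmat_mul_lmat hq, Matrix.mul_smul, ← Matrix.mul_assoc (Rmat h),
    rmat_mul_astarInv hq]
  simp only [Matrix.mul_assoc, Matrix.smul_mul, smul_smul, pow_two, mul_inv]

theorem raising_lowering_relations {q : ℕ} (hq : Fintype.card F = q) :
    (Lmat h q ^ 2 * Rmat h - ((q : ℂ) * ((q : ℂ) + 1)) • (Lmat h q * Rmat h * Lmat h q)
        + ((q : ℂ) ^ 3) • (Rmat h * Lmat h q ^ 2)
      = (-((q : ℂ) ^ finrank F H * ((q : ℂ) + 1))) • Lmat h q) ∧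
    Lmat h q * Rmat h ^ 2 - ((q : ℂ) * ((q : ℂ) + 1)) • (Rmat h * Lmat h q * Rmat h)
        + ((q : ℂ) ^ 3) • (Rmat h ^ 2 * Lmat h q)
      = (-((q : ℂ) ^ finrank F H * ((q : ℂ) + 1))) • Rmat h := by
  have low := lowering_relation (h := h)
  have rai := raising_relation (h := h)
  rw [hq] at low rai
  replace hq : q ≠ 0 := hq ▸ Fintype.card_ne_zero
  have hq' : (q : ℂ) ≠ 0 := Nat.cast_ne_zero.2 hq
  constructor
  · have key := congrArg (fun B => (q : ℂ) • (AstarInv h q * (AstarInv h q * B))) low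
    simp only [Matrix.mul_add, Matrix.mul_sub, Matrix.mul_smul] at key
    rw [← Matrix.mul_assoc (AstarInv h q) (Astar h q), astarInv_mul_astar hq, Matrix.one_mul,
      ← lmat_eq] at key
    rw [lmat_sq_mul_rmat, lmat_mul_rmat_mul_lmat hq, rmat_mul_lmat_sq hq]
    convert key using 1
    · simp only [smul_add, smul_sub, smul_smul]
      congr 2
      field_simp
    · rw [smul_smul]
      congr 1
      field_simp
  · have key := congrArg (fun B => AstarInv h q * B) rai
    simp only [Matrix.mul_add, Matrix.mul_sub, Matrix.mul_smul] at key
    rw [← Matrix.mul_assoc (AstarInv h q) (Rmat h) (Astar h q), astarInv_mul_rmat, Matrix.smul_mul,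
      Matrix.mul_assoc (Rmat h) (AstarInv h q), astarInv_mul_astar hq, Matrix.mul_one] at key
    rw [rmat_mul_lmat hq, rmat_sq_mul_lmat hq, lmat_eq, pow_two]
    simp only [Matrix.smul_mul, Matrix.mul_assoc] at key ⊢
    convert key using 1
    · simp only [smul_smul]
      congr 3 <;> field_simp
    · rw [smul_smul]
      congr 1
      field_simp

end Products

/-- the relations satisfied by `R`, `L`, `A*`. -/
theorem stmt4 (q N M : ℕ) (hq : Fintype.card F = q) (hN : 0 < N) (hM : 0 < M)
    (h : Submodule F H) (hH : finrank F H = N + M) (hh : finrank F h = M) :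
    Rmat h * Astar h q = (q : ℂ) • (Astar h q * Rmat h) ∧
    Lmat h q * Astar h q = (q : ℂ)⁻¹ • (Astar h q * Lmat h q) ∧
    Lmat h q ^ 2 * Rmat h - ((q : ℂ) * ((q : ℂ) + 1)) • (Lmat h q * Rmat h * Lmat h q)
        + ((q : ℂ) ^ 3) • (Rmat h * Lmat h q ^ 2)
      = (-((q : ℂ) ^ (N + M) * ((q : ℂ) + 1))) • Lmat h q ∧
    Lmat h q * Rmat h ^ 2 - ((q : ℂ) * ((q : ℂ) + 1)) • (Rmat h * Lmat h q * Rmat h)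
        + ((q : ℂ) ^ 3) • (Rmat h ^ 2 * Lmat h q)
      = (-((q : ℂ) ^ (N + M) * ((q : ℂ) + 1))) • Rmat h := by
  have hq0 : q ≠ 0 := hq ▸ Fintype.card_ne_zero
  rw [← hH]
  exact ⟨rmat_mul_astar hq0, lmat_mul_astar hq0, raising_lowering_relations hq⟩
end
end

section
/- With β = q + q^{−1}, the matrices A and A* satisfy (A*)³A − (β+1)(A*)²AA* + (β+1) A*A(A*)² − A(A*)³ = 0. -/
open Module Matrix Finset

noncomputable section

open scoped Classical

variable {F H : Type} [Field F] [Fintype F] [AddCommGroup H] [Module F H]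
  [FiniteDimensional F H]

/-- with `β = q + q⁻¹`, the dual tridiagonal relation for `A` and `A*`. -/
theorem stmt7 (q N M : ℕ) (hq : Fintype.card F = q) (hN : 0 < N) (hM : 0 < M)
    (h : Submodule F H) (hH : finrank F H = N + M) (hh : finrank F h = M)
    (β : ℂ) (hβ : β = (q : ℂ) + (q : ℂ)⁻¹) :
    Astar h q ^ 3 * Amat h q - (β + 1) • (Astar h q ^ 2 * Amat h q * Astar h q)
        + (β + 1) • (Astar h q * Amat h q * Astar h q ^ 2) - Amat h q * Astar h q ^ 3
      = 0 := by
  have q_ne_zero : (q : ℂ) ≠ 0 := by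
    rw [← hq]
    exact_mod_cast Fintype.card_ne_zero
  have dual_poly_eq_zero (a b : ℂ) (hab : b = q * a) :
      a ^ 3 - (β + 1) * (a ^ 2 * b) + (β + 1) * (a * b ^ 2) - b ^ 3 = 0 ∧
        b ^ 3 - (β + 1) * (b ^ 2 * a) + (β + 1) * (b * a ^ 2) - a ^ 3 = 0 := by
    subst hab hβ
    constructor <;> field_simp <;> ring
  have pow_eq {m n : ℕ} (hmn : m = n + 1) :
      (q : ℂ) ^ (-(n : ℤ)) = q * (q : ℂ) ^ (-(m : ℤ)) := by
    rw [← zpow_one_add₀ q_ne_zero, hmn]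
    congr 1
    push_cast
    ring
  ext y z
  simp only [Astar, Matrix.diagonal_pow, Matrix.sub_apply, Matrix.add_apply, Matrix.smul_apply,
    Matrix.diagonal_mul, Matrix.mul_diagonal, Pi.pow_apply, smul_eq_mul, Matrix.zero_apply]
  by_cases hzy : AttCovers h z y
  · linear_combination Amat h q y z * (dual_poly_eq_zero _ _ (pow_eq hzy.2)).1
  by_cases hyz : AttCovers h y z
  · linear_combination Amat h q y z * (dual_poly_eq_zero _ _ (pow_eq hyz.2)).2
  simp [Amat, hzy, hyz]
end
end

section
/- The (d+1)×(d+1) real tridiagonal matrix with zero diagonal, all subdiagonal entries equal to 1, and superdiagonal entries ξ_1, …, ξ_d is multiplicity-free: it is diagonalizable with d+1 mutually distinct eigenvalues, namely (q^{d−i} − q^i)/(q − 1) · q^{m/2} for 0 ≤ i ≤ d, where q^{1/2} denotes the positive square root of q. -/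
noncomputable section

open Polynomial in
/-- The product `∏_{j<k} (1 - q^j X) · ∏_{j<l} (1 + q^j X)`, the generating function of the
entries of an eigenvector (up to rescaling). -/
def eigenPoly (q : ℝ) (k l : ℕ) : ℝ[X] :=
  (∏ j ∈ Finset.range k, (1 - C (q ^ j) * X)) * ∏ j ∈ Finset.range l, (1 + C (q ^ j) * X)

open Polynomial in
lemma prod_one_add_comp (q e : ℝ) (k : ℕ) :
    (∏ j ∈ Finset.range k, (1 + C (e * q ^ j) * X)).comp (C q * X) * (1 + C e * X) =
      (∏ j ∈ Finset.range k, (1 + C (e * q ^ j) * X)) * (1 + C (e * q ^ k) * X) := by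
  rw [← Finset.prod_range_succ, Finset.prod_range_succ', Polynomial.prod_comp]
  congr 1
  · refine Finset.prod_congr rfl fun j _ => ?_
    simp only [add_comp, one_comp, mul_comp, C_comp, X_comp, ← mul_assoc, ← C_mul, pow_succ]
  · simp

open Polynomial in
lemma eigenPoly_comp (q : ℝ) (k l : ℕ) :
    (eigenPoly q k l).comp (C q * X) * (1 - X ^ 2) =
      eigenPoly q k l * (1 + C (q ^ l - q ^ k) * X - C (q ^ k * q ^ l) * X ^ 2) := by
  have h₁ := prod_one_add_comp q (-1) k
  have h₂ := prod_one_add_comp q 1 l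
  simp only [one_mul, C_neg, neg_mul, ← sub_eq_add_neg, C_1] at h₁ h₂
  rw [eigenPoly, mul_comp, C_sub, C_mul]
  linear_combination h₁ * (∏ j ∈ Finset.range l, (1 + C (q ^ j) * X)).comp (C q * X) * (1 + X) +
    (∏ j ∈ Finset.range k, (1 - C (q ^ j) * X)) * (1 - C (q ^ k) * X) * h₂

lemma eigenPoly_coeff_zero (q : ℝ) (k l : ℕ) : (eigenPoly q k l).coeff 0 = 1 := by
  simp [eigenPoly, Polynomial.coeff_zero_eq_eval_zero, Polynomial.eval_prod]

open Polynomial in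
lemma eigenPoly_natDegree_le (q : ℝ) (k l : ℕ) : (eigenPoly q k l).natDegree ≤ k + l := by
  refine natDegree_mul_le.trans (add_le_add ?_ ?_) <;>
  · refine (natDegree_prod_le _ _).trans ((Finset.sum_le_card_nsmul _ _ 1 fun j _ => ?_).trans ?_)
    · compute_degree
    · simp

lemma eigenPoly_coeff_one (q : ℝ) (k l : ℕ) :
    (q - 1) * (eigenPoly q k l).coeff 1 = (q ^ l - q ^ k) * (eigenPoly q k l).coeff 0 := by
  have h := congrArg (fun p => Polynomial.coeff p 1) (eigenPoly_comp q k l)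
  simp only [mul_sub, mul_add, mul_one, Polynomial.coeff_sub, Polynomial.coeff_add,
    Polynomial.coeff_mul_X_pow', Polynomial.comp_C_mul_X_coeff, mul_left_comm _ (Polynomial.C _),
    Polynomial.coeff_C_mul, Polynomial.coeff_mul_X] at h
  norm_num at h
  linear_combination h

lemma eigenPoly_coeff_add_two (q : ℝ) (k l i : ℕ) :
    (q ^ (i + 2) - 1) * (eigenPoly q k l).coeff (i + 2)
        + (q ^ (k + l) - q ^ i) * (eigenPoly q k l).coeff i =
      (q ^ l - q ^ k) * (eigenPoly q k l).coeff (i + 1) := by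
  have h := congrArg (fun p => Polynomial.coeff p (i + 2)) (eigenPoly_comp q k l)
  simp only [mul_sub, mul_add, mul_one, Polynomial.coeff_sub, Polynomial.coeff_add,
    Polynomial.coeff_mul_X_pow, Polynomial.comp_C_mul_X_coeff, mul_left_comm _ (Polynomial.C _),
    Polynomial.coeff_C_mul, Polynomial.coeff_mul_X] at h
  rw [pow_add q k l]
  linear_combination h

/-- Multiplying a tridiagonal matrix with zero diagonal and unit subdiagonal by a vector. -/
lemma tridiagonal_mulVec (d : ℕ) (ξ v : ℕ → ℝ) (hv : v (d + 1) = 0)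
    (B : Matrix (Fin (d + 1)) (Fin (d + 1)) ℝ)
    (hB : ∀ i j : Fin (d + 1), B i j =
      if (j : ℕ) = (i : ℕ) + 1 then ξ ((i : ℕ) + 1)
      else if (i : ℕ) = (j : ℕ) + 1 then 1 else 0) (i : Fin (d + 1)) :
    B.mulVec (fun j => v j) i =
      ξ (i + 1) * v (i + 1) + if (i : ℕ) = 0 then 0 else v (i - 1) := by
  have hi := i.isLt
  have h : ∀ j : ℕ, (if j = (i : ℕ) + 1 then ξ (i + 1) else if (i : ℕ) = j + 1 then 1 else 0) * v j
      = (if j = (i : ℕ) + 1 then ξ (i + 1) * v (i + 1) else 0)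
        + if (i : ℕ) = j + 1 then v (i - 1) else 0 := by
    intro j
    split_ifs with h₁ h₂ h₂
    · omega
    · rw [h₁, add_zero]
    · simp [h₂]
    · simp
  simp only [Matrix.mulVec, dotProduct, hB]
  rw [Fin.sum_univ_eq_sum_range (fun j => (if j = (i : ℕ) + 1 then ξ (i + 1)
    else if (i : ℕ) = j + 1 then 1 else 0) * v j)]
  simp only [h, Finset.sum_add_distrib]
  congr 1
  · rw [Finset.sum_ite_eq' (Finset.range (d + 1))]
    split_ifs with h₁
    · rfl
    · rw [Finset.mem_range] at h₁
      rw [show (i : ℕ) + 1 = d + 1 by omega, hv, mul_zero]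
  · split_ifs with h₁
    · exact Finset.sum_eq_zero fun j _ => if_neg (by omega)
    · rw [Finset.sum_eq_single ((i : ℕ) - 1)]
      · exact if_pos (by omega)
      · exact fun j _ hj => if_neg (by omega)
      · intro hj
        rw [Finset.mem_range] at hj
        omega

/-- A square matrix with nonzero eigenvectors for pairwise distinct eigenvalues is diagonalized by
the matrix of these eigenvectors. -/
lemma diagonalized_of_eigenvectors {n : Type*} [Fintype n] [DecidableEq n] (B : Matrix n n ℝ)
    (θ : n → ℝ) (hθ : Function.Injective θ) (v : n → n → ℝ) (hv : ∀ k, v k ≠ 0)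
    (h : ∀ k, B.mulVec (v k) = θ k • v k) :
    ∃ P : Matrix n n ℝ, IsUnit P.det ∧ P⁻¹ * B * P = Matrix.diagonal θ := by
  have hli : LinearIndependent ℝ v :=
    Module.End.eigenvectors_linearIndependent' (Matrix.toLin' B) θ hθ v fun k =>
      Module.End.hasEigenvector_iff.mpr
        ⟨Module.End.mem_eigenspace_iff.mpr (by rw [Matrix.toLin'_apply, h k]), hv k⟩
  have hP : IsUnit (Matrix.of v).transpose.det := by
    rw [← Matrix.isUnit_iff_isUnit_det, ← Matrix.linearIndependent_cols_iff_isUnit]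
    exact hli
  refine ⟨(Matrix.of v).transpose, hP, ?_⟩
  have hmul : B * (Matrix.of v).transpose = (Matrix.of v).transpose * Matrix.diagonal θ := by
    ext i k
    have := congrFun (h k) i
    rw [Matrix.mul_diagonal]
    simpa [Matrix.mulVec, dotProduct, Matrix.mul_apply, mul_comm] using this
  rw [Matrix.mul_assoc, hmul, Matrix.nonsing_inv_mul_cancel_left _ _ hP]

/-- the `(d+1)×(d+1)` real tridiagonal matrix with zero diagonal, subdiagonal
entries `1` and superdiagonal entries `ξ_1, …, ξ_d` (where
`ξ_i = q^m (q^i - 1)(q^d - q^(i-1))/(q-1)²`) is multiplicity-free, with `d+1` mutually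
distinct eigenvalues `(q^(d-i) - q^i)/(q-1) · q^(m/2)` for `0 ≤ i ≤ d`. -/
theorem stmt9 (q d m : ℕ) (hq : 2 ≤ q)
    (ξ : ℕ → ℝ)
    (hξ : ∀ i : ℕ, 1 ≤ i → i ≤ d →
      ξ i = (q : ℝ) ^ m * ((q : ℝ) ^ i - 1) * ((q : ℝ) ^ d - (q : ℝ) ^ (i - 1)) / ((q : ℝ) - 1) ^ 2)
    (B : Matrix (Fin (d + 1)) (Fin (d + 1)) ℝ)
    (hB : ∀ i j : Fin (d + 1), B i j =
      if (j : ℕ) = (i : ℕ) + 1 then ξ ((i : ℕ) + 1)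
      else if (i : ℕ) = (j : ℕ) + 1 then 1 else 0)
    (θ : Fin (d + 1) → ℝ)
    (hθ : ∀ i : Fin (d + 1),
      θ i = ((q : ℝ) ^ (d - (i : ℕ)) - (q : ℝ) ^ (i : ℕ)) / ((q : ℝ) - 1) * Real.sqrt q ^ m) :
    Function.Injective θ ∧
    ∃ P : Matrix (Fin (d + 1)) (Fin (d + 1)) ℝ,
      IsUnit P.det ∧ P⁻¹ * B * P = Matrix.diagonal θ := by
  have hq1 : (1 : ℝ) < q := by exact_mod_cast hq
  have hq0 : (q : ℝ) - 1 ≠ 0 := by linarith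
  set s : ℝ := Real.sqrt q ^ m with hs
  have hs0 : 0 < s := pow_pos (Real.sqrt_pos.mpr (by linarith)) m
  have hs2 : (q : ℝ) ^ m = s * s := by
    rw [hs, ← mul_pow, Real.mul_self_sqrt (by linarith)]
  have hanti : StrictAnti θ := by
    intro i j hij
    have hj := j.isLt
    rw [hθ, hθ]
    have h₁ : (q : ℝ) ^ (i : ℕ) < (q : ℝ) ^ (j : ℕ) := pow_lt_pow_right₀ hq1 hij
    have h₂ : (q : ℝ) ^ (d - (j : ℕ)) < (q : ℝ) ^ (d - (i : ℕ)) :=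
      pow_lt_pow_right₀ hq1 (by have : (i : ℕ) < j := hij; omega)
    exact mul_lt_mul_of_pos_right (div_lt_div_of_pos_right (by linarith) (by linarith)) hs0
  refine ⟨hanti.injective, ?_⟩
  let c : ℕ → ℝ := fun i => (∏ j ∈ Finset.range i, (s * ((q : ℝ) ^ d - (q : ℝ) ^ j) / (q - 1)))⁻¹
  have hc : ∀ i < d, c i = c (i + 1) * (s * ((q : ℝ) ^ d - (q : ℝ) ^ i) / (q - 1)) := by
    intro i hi
    have h₁ : (q : ℝ) ^ i < (q : ℝ) ^ d := pow_lt_pow_right₀ hq1 hi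
    have h₂ : s * ((q : ℝ) ^ d - (q : ℝ) ^ i) / (q - 1) ≠ 0 :=
      div_ne_zero (mul_ne_zero hs0.ne' (by linarith)) hq0
    simp only [c, Finset.prod_range_succ]
    rw [mul_inv, mul_assoc, inv_mul_cancel₀ h₂, mul_one]
  let w : Fin (d + 1) → ℕ → ℝ := fun k i => (eigenPoly q k (d - k)).coeff i
  have hw : ∀ k, w k (d + 1) = 0 := fun k =>
    Polynomial.coeff_eq_zero_of_natDegree_lt
      ((eigenPoly_natDegree_le _ _ _).trans_lt (by have := k.isLt; omega))
  have hsup : ∀ k, ∀ i ≤ d, ξ (i + 1) * (c (i + 1) * w k (i + 1)) =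
      c i * s * (((q : ℝ) ^ (i + 1) - 1) * w k (i + 1)) / (q - 1) := by
    intro k i hi
    rcases hi.eq_or_lt with rfl | hi
    · simp [hw]
    · rw [hξ (i + 1) (by omega) hi, hc i hi, hs2, Nat.add_sub_cancel]
      field_simp
  refine diagonalized_of_eigenvectors B θ hanti.injective (fun k i => c i * w k i) ?_ ?_
  · intro k hk
    have := congrFun hk 0
    simp [c, w, eigenPoly_coeff_zero] at this
  · intro k
    funext i
    rw [tridiagonal_mulVec d ξ (fun i => c i * w k i) (by simp [hw]) B hB i, Pi.smul_apply,
      smul_eq_mul, hθ, hsup k i (by omega)]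
    obtain ⟨i, hi⟩ := i
    rcases i with _ | i
    · have h := eigenPoly_coeff_one q k (d - k)
      simp only [if_true, zero_add, pow_one, add_zero, w]
      rw [h]
      ring
    · have h := eigenPoly_coeff_add_two q k (d - k) i
      rw [show (k : ℕ) + (d - k) = d by have := k.isLt; omega] at h
      simp only [Nat.add_eq_zero_iff, one_ne_zero, and_false, if_false, Nat.add_sub_cancel, w]
      rw [hc i (by omega)]
      linear_combination c (i + 1) * s / (q - 1) * h
end
end
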